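/- Let G be a (theta, prism)-free graph and let W = (H, c) be a non-special wheel in G such that the hole H has length at least seven. Let a and b be vertices of G \ N[Z(W)] that belong to the interiors of distinct sectors of W. Then N[Z(W)] separates a and b in G. -/

import Mathlib

open SimpleGraph

namespace Paper

variable {V : Type}

/-- Two vertex sets are anticomplete: no edges between them. -/
def Anticomplete (G : SimpleGraph V) (A B : Set V) : Prop :=
  ∀ a ∈ A, ∀ b ∈ B, ¬ G.Adj a b

/-- A stable (independent) set of vertices. -/
def StableSet (G : SimpleGraph V) (A : Set V) : Prop :=
  ∀ x ∈ A, ∀ y ∈ A, x ≠ y → ¬ G.Adj x y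

/-- A walk is induced in `G`: any two adjacent vertices on it are consecutive. -/
def InducedWalk (G : SimpleGraph V) {u v : V} (P : G.Walk u v) : Prop :=
  ∀ x ∈ P.support, ∀ y ∈ P.support, G.Adj x y → s(x, y) ∈ P.edges

/-- The interior (set of internal vertices) of a walk from `u` to `v`. -/
def Interior {G : SimpleGraph V} {u v : V} (P : G.Walk u v) : Set V :=
  {w | w ∈ P.support ∧ w ≠ u ∧ w ≠ v}

/-- Closed neighborhood of a set of vertices. -/
def ClosedNbhd (G : SimpleGraph V) (A : Set V) : Set V :=
  A ∪ {v | ∃ a ∈ A, G.Adj v a}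

/-- Open neighborhood of a set of vertices. -/
def OpenNbhd (G : SimpleGraph V) (A : Set V) : Set V :=
  {v | v ∉ A ∧ ∃ a ∈ A, G.Adj v a}

/-- `M` separates `x` and `y` in `G`: there is a separation `(L, M, R)` with `x ∈ L`, `y ∈ R`. -/
def Separates (G : SimpleGraph V) (M : Set V) (x y : V) : Prop :=
  ∃ L R : Set V,
    L ∪ M ∪ R = Set.univ ∧
    Disjoint L M ∧ Disjoint L R ∧ Disjoint M R ∧
    L.Nonempty ∧ R.Nonempty ∧ Anticomplete G L R ∧ x ∈ L ∧ y ∈ R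

/-- `G` contains a theta as an induced subgraph. -/
def ContainsTheta (G : SimpleGraph V) : Prop :=
  ∃ (a b : V) (P₁ P₂ P₃ : G.Walk a b),
    a ≠ b ∧ ¬ G.Adj a b ∧
    P₁.IsPath ∧ P₂.IsPath ∧ P₃.IsPath ∧
    InducedWalk G P₁ ∧ InducedWalk G P₂ ∧ InducedWalk G P₃ ∧
    2 ≤ P₁.length ∧ 2 ≤ P₂.length ∧ 2 ≤ P₃.length ∧
    Disjoint (Interior P₁) (Interior P₂) ∧
    Disjoint (Interior P₁) (Interior P₃) ∧
    Disjoint (Interior P₂) (Interior P₃) ∧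
    Anticomplete G (Interior P₁) (Interior P₂) ∧
    Anticomplete G (Interior P₁) (Interior P₃) ∧
    Anticomplete G (Interior P₂) (Interior P₃)

/-- `G` contains a prism as an induced subgraph (one path may have length zero). -/
def ContainsPrism (G : SimpleGraph V) : Prop :=
  ∃ (a b : Fin 3 → V) (P : ∀ i, G.Walk (a i) (b i)),
    (∀ i j, i ≠ j → G.Adj (a i) (a j)) ∧
    (∀ i j, i ≠ j → G.Adj (b i) (b j)) ∧
    (∀ i, (P i).IsPath) ∧ (∀ i, InducedWalk G (P i)) ∧
    (∀ i j, i ≠ j → ∀ x, x ∈ (P i).support → x ∉ (P j).support) ∧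
    (∀ i j, i ≠ j → ∀ x ∈ (P i).support, ∀ y ∈ (P j).support,
        G.Adj x y → (x = a i ∧ y = a j) ∨ (x = b i ∧ y = b j)) ∧
    (∀ i j, i ≠ j → 2 ≤ (P i).length + (P j).length)

/-- `G` contains `K_{1,t}` as an induced subgraph. -/
def ContainsK1t (G : SimpleGraph V) (t : ℕ) : Prop :=
  ∃ (v : V) (S : Finset V),
    S.card = t ∧ v ∉ S ∧ (∀ x ∈ S, G.Adj v x) ∧ StableSet G ↑S

/-- `G` belongs to the class `C_t` of (theta, prism, `K_{1,t}`)-free graphs. -/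
def MemCt (t : ℕ) (G : SimpleGraph V) : Prop :=
  ¬ ContainsTheta G ∧ ¬ ContainsPrism G ∧ ¬ ContainsK1t G t

/-- A tree decomposition of `G`. -/
structure TreeDecomp (G : SimpleGraph V) where
  ι : Type
  T : SimpleGraph ι
  isTree : T.IsTree
  bag : ι → Set V
  mem_bag : ∀ v : V, ∃ i, v ∈ bag i
  edge_bag : ∀ u v : V, G.Adj u v → ∃ i, u ∈ bag i ∧ v ∈ bag i
  bag_connected : ∀ v : V, (T.induce {i | v ∈ bag i}).Connected

/-- The tree independence number of `G` is at most `k`. -/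
def TreeAlphaLE (G : SimpleGraph V) (k : ℕ) : Prop :=
  ∃ D : TreeDecomp G, ∀ i : D.ι, ∀ S : Finset V,
    ↑S ⊆ D.bag i → StableSet G ↑S → S.card ≤ k

/-- Sum of weights over a vertex set. -/
noncomputable def wSum [Fintype V] (w : V → ℝ) (A : Set V) : ℝ :=
  ∑ v, A.indicator w v

/-- `D` is a connected component of `G \ X`. -/
def IsComponentOf (G : SimpleGraph V) (X D : Set V) : Prop :=
  D.Nonempty ∧ D ⊆ Xᶜ ∧ (G.induce D).Connected ∧
  ∀ D' : Set V, D ⊆ D' → D' ⊆ Xᶜ → (G.induce D').Connected → D' = D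

/-- `X` is a `w`-balanced separator in `G`. -/
def BalancedSeparator [Fintype V] (G : SimpleGraph V) (w : V → ℝ) (X : Set V) : Prop :=
  ∀ D : Set V, IsComponentOf G X D → wSum w D ≤ 1 / 2

/-- A closed walk is a hole (induced cycle of length at least four) in `G`. -/
def IsHoleWalk (G : SimpleGraph V) {h : V} (H : G.Walk h h) : Prop :=
  H.IsCycle ∧ 4 ≤ H.length ∧ InducedWalk G H

/-- The neighbors of `c` on the hole `H`. -/
def HoleNbrs (G : SimpleGraph V) {h : V} (H : G.Walk h h) (c : V) : Set V :=
  {v | v ∈ H.support ∧ G.Adj c v}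

/-- `(H, c)` is a wheel in `G`. -/
def IsWheel (G : SimpleGraph V) {h : V} (H : G.Walk h h) (c : V) : Prop :=
  IsHoleWalk G H ∧ c ∉ H.support ∧ 3 ≤ (HoleNbrs G H c).ncard

/-- `P` is a sector of the wheel `(H, c)`. -/
def IsSector (G : SimpleGraph V) {h : V} (H : G.Walk h h) (c : V)
    {x y : V} (P : G.Walk x y) : Prop :=
  P.IsPath ∧ 0 < P.length ∧
  (∀ w ∈ P.support, w ∈ H.support) ∧
  (∀ e ∈ P.edges, e ∈ H.edges) ∧
  G.Adj c x ∧ G.Adj c y ∧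
  ∀ w ∈ P.support, w ≠ x → w ≠ y → ¬ G.Adj c w

/-- The wheel `(H, c)` is special. -/
def IsSpecialWheel (G : SimpleGraph V) {h : V} (H : G.Walk h h) (c : V) : Prop :=
  IsWheel G H c ∧ ∃ a b d : V,
    a ≠ b ∧ a ≠ d ∧ b ≠ d ∧
    HoleNbrs G H c = {a, b, d} ∧
    s(a, b) ∈ H.edges ∧ s(a, d) ∉ H.edges ∧ s(b, d) ∉ H.edges

/-- `Z(W)` for a non-special wheel `W = (H, c)`. -/
def ZNonSpecial (G : SimpleGraph V) {h : V} (H : G.Walk h h) (c : V) : Set V :=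
  {c} ∪ HoleNbrs G H c

/-- `Z(W)` for a special wheel `W = (H, c)` with length-one sector `ab` and third neighbor `d`. -/
def ZSpecial (G : SimpleGraph V) {h : V} (H : G.Walk h h) (c a b d : V) : Set V :=
  ({a, b, c, d} : Set V) ∪ {v | s(v, d) ∈ H.edges}

/-- A pyramid in `G` with apex `apx`, base `b 0, b 1, b 2` and paths `P i`. -/
def IsPyramid (G : SimpleGraph V) (apx : V) (b : Fin 3 → V)
    (P : ∀ i, G.Walk apx (b i)) : Prop :=
  (∀ i, b i ≠ apx) ∧
  (∀ i j, i ≠ j → G.Adj (b i) (b j)) ∧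
  (∀ i, (P i).IsPath) ∧ (∀ i, InducedWalk G (P i)) ∧
  (∀ i, 1 ≤ (P i).length) ∧
  (∀ i j, i ≠ j → ∀ x, x ∈ (P i).support → x ∈ (P j).support → x = apx) ∧
  (∀ i j, i ≠ j → ∀ x ∈ (P i).support, ∀ y ∈ (P j).support,
      x ≠ apx → y ≠ apx → G.Adj x y → x = b i ∧ y = b j) ∧
  (∀ i j, i ≠ j → 3 ≤ (P i).length + (P j).length)

/-- `Z(Σ)` for a pyramid. -/
def ZPyramid (G : SimpleGraph V) (apx : V) (b : Fin 3 → V)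
    (P : ∀ i, G.Walk apx (b i)) : Set V :=
  {apx} ∪ {v | (∃ i, v ∈ (P i).support) ∧ G.Adj apx v} ∪ Set.range b

/-- `x : Fin k → V` enumerates `X` in an order witnessing that `(P, X)` is an alignment. -/
def AlignmentOrder (G : SimpleGraph V) {p q : V} (P : G.Walk p q)
    (X : Finset V) {k : ℕ} (x : Fin k → V) : Prop :=
  Function.Injective x ∧ (∀ l, x l ∈ X) ∧ (∀ z ∈ X, ∃ l, x l = z) ∧
  ∃ lo hi : Fin k → ℕ,
    (∀ l, lo l ≤ hi l) ∧
    (∀ l m : Fin k, l < m → hi l < lo m) ∧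
    (∀ l, hi l < P.support.length) ∧
    ∀ (l : Fin k) (n : Fin P.support.length),
      G.Adj (x l) (P.support.get n) → lo l ≤ (n : ℕ) ∧ (n : ℕ) ≤ hi l

/-- `(P, X)` is an alignment. -/
def IsAlignment (G : SimpleGraph V) {p q : V} (P : G.Walk p q) (X : Finset V) : Prop :=
  (∀ z ∈ X, z ∉ P.support) ∧
  (∀ z ∈ X, ∃ u ∈ P.support, G.Adj z u) ∧
  ∃ (k : ℕ) (x : Fin k → V), AlignmentOrder G P X x

/-- Every vertex of `X` has two non-adjacent neighbors in `P`. -/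
def WideAl (G : SimpleGraph V) {p q : V} (P : G.Walk p q) (X : Finset V) : Prop :=
  ∀ z ∈ X, ∃ u v : V, u ∈ P.support ∧ v ∈ P.support ∧
    G.Adj z u ∧ G.Adj z v ∧ u ≠ v ∧ ¬ G.Adj u v

/-- Every vertex of `X` has a unique neighbor in `P`. -/
def SpikyAl (G : SimpleGraph V) {p q : V} (P : G.Walk p q) (X : Finset V) : Prop :=
  ∀ z ∈ X, ∃! u : V, u ∈ P.support ∧ G.Adj z u

/-- Every vertex of `X` has exactly two neighbors in `P`, and they are adjacent. -/
def TriangularAl (G : SimpleGraph V) {p q : V} (P : G.Walk p q) (X : Finset V) : Prop :=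
  ∀ z ∈ X, ∃ u v : V, u ∈ P.support ∧ v ∈ P.support ∧
    G.Adj z u ∧ G.Adj z v ∧ u ≠ v ∧ G.Adj u v ∧
    ∀ w ∈ P.support, G.Adj z w → w = u ∨ w = v

/-- `(P, X)` is a consistent alignment. -/
def ConsistentAlignment (G : SimpleGraph V) {p q : V} (P : G.Walk p q) (X : Finset V) : Prop :=
  IsAlignment G P X ∧ (WideAl G P X ∨ SpikyAl G P X ∨ TriangularAl G P X)

/-- A branch vertex of a graph: a vertex of degree at least three. -/
def BranchVtx {W : Type} (T : SimpleGraph W) (v : W) : Prop :=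
  3 ≤ (T.neighborSet v).ncard

/-- `T` is a caterpillar: a tree of maximum degree three, no two branch vertices adjacent,
and some path contains all branch vertices. -/
def IsCaterpillar {W : Type} (T : SimpleGraph W) : Prop :=
  T.IsTree ∧ (∀ v, (T.neighborSet v).ncard ≤ 3) ∧
  (∀ u v, BranchVtx T u → BranchVtx T v → ¬ T.Adj u v) ∧
  ∃ (x y : W) (P : T.Walk x y), P.IsPath ∧ ∀ v, BranchVtx T v → v ∈ P.support

/-- `T` is a subdivided star with root `r`. -/
def IsSubdividedStar {W : Type} (T : SimpleGraph W) (r : W) : Prop :=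
  T.IsTree ∧ 3 ≤ (T.neighborSet r).ncard ∧ ∀ v, v ≠ r → (T.neighborSet v).ncard ≤ 2

/-- `H` is isomorphic to the line graph of a caterpillar. -/
def IsLineCaterpillar {U : Type} (H : SimpleGraph U) : Prop :=
  ∃ (W : Type) (T : SimpleGraph W), IsCaterpillar T ∧ Nonempty (H ≃g T.lineGraph)

/-- `H` is isomorphic to the line graph of a subdivided star. -/
def IsLineSubdividedStar {U : Type} (H : SimpleGraph U) : Prop :=
  ∃ (W : Type) (T : SimpleGraph W) (r : W),
    IsSubdividedStar T r ∧ Nonempty (H ≃g T.lineGraph)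

/-- `v` is a simplicial vertex of `G[S]`. -/
def SimplicialIn (G : SimpleGraph V) (S : Set V) (v : V) : Prop :=
  v ∈ S ∧ ∀ u ∈ S, ∀ w ∈ S, G.Adj v u → G.Adj v w → u ≠ w → G.Adj u w

/-- `G[S]` is one of the four connectifier shapes. -/
def ConnType (G : SimpleGraph V) (S : Set V) : Prop :=
  IsCaterpillar (G.induce S) ∨ IsLineCaterpillar (G.induce S) ∨
  (∃ r, IsSubdividedStar (G.induce S) r) ∨ IsLineSubdividedStar (G.induce S)

/-- `(G[S], X)` is a connectifier. -/
def IsConnectifier (G : SimpleGraph V) (S : Set V) (X : Finset V) : Prop :=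
  (∀ z ∈ X, (z : V) ∉ S) ∧ (∀ z ∈ X, ∃ r ∈ S, G.Adj z r) ∧
  ( (∃ v, S = {v}) ∨
    ( ConnType G S ∧
      (∀ z ∈ X, ∀ r₁ ∈ S, ∀ r₂ ∈ S, G.Adj z r₁ → G.Adj z r₂ → r₁ = r₂) ∧
      (∀ z ∈ X, ∀ r ∈ S, G.Adj z r → SimplicialIn G S r) ∧
      (∀ v, SimplicialIn G S v → ∃ z ∈ X, G.Adj z v) ) )

/-- The connectifier `(G[S], X)` is concentrated. -/
def Concentrated (G : SimpleGraph V) (S : Set V) : Prop :=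
  (∃ v, S = {v}) ∨ (∃ r, IsSubdividedStar (G.induce S) r) ∨
  IsLineSubdividedStar (G.induce S)

/-- Reachability inside a vertex set `A`. -/
def Reaches (G : SimpleGraph V) (A : Set V) (u v : V) : Prop :=
  ∃ (w : G.Walk u v), ∀ z ∈ w.support, z ∈ A

/-- `Pw` is a spine of the caterpillar `G[S]`: a maximal path containing all branch vertices. -/
def IsSpineOf (G : SimpleGraph V) (S : Set V) {p q : V} (Pw : G.Walk p q) : Prop :=
  Pw.IsPath ∧ (∀ w ∈ Pw.support, w ∈ S) ∧
  (∀ v ∈ S, 3 ≤ ({u | u ∈ S ∧ G.Adj v u}).ncard → v ∈ Pw.support) ∧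
  ∀ (p' q' : V) (P' : G.Walk p' q'), P'.IsPath → (∀ w ∈ P'.support, w ∈ S) →
    (∀ w ∈ Pw.support, w ∈ P'.support) → ∀ w ∈ P'.support, w ∈ Pw.support

/-- `Pw` realizes `P(H)` for `H = G[S]`, when `H` is a caterpillar or the line graph
of a caterpillar. -/
def IsPHOf (G : SimpleGraph V) (S : Set V) {p q : V} (Pw : G.Walk p q) : Prop :=
  Pw.IsPath ∧ (∀ w ∈ Pw.support, w ∈ S) ∧
  ( (IsCaterpillar (G.induce S) ∧ IsSpineOf G S Pw) ∨
    (∃ (W : Type) (T : SimpleGraph W) (φ : T.lineGraph ≃g G.induce S)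
        (x y : W) (Q : T.Walk x y),
      IsCaterpillar T ∧ Q.IsPath ∧
      (∀ v, BranchVtx T v → v ∈ Q.support) ∧
      (∀ (x' y' : W) (Q' : T.Walk x' y'), Q'.IsPath →
        (∀ w ∈ Q.support, w ∈ Q'.support) → ∀ w ∈ Q'.support, w ∈ Q.support) ∧
      {w | w ∈ Pw.support} = {v : V | ∃ e : T.edgeSet, (e : Sym2 W) ∈ Q.edges ∧ ↑(φ e) = v}) )

/-- `x` enumerates `X` in the order given by the (non-concentrated) connectifier `(G[S], X)`
with central path `Pw = P(H)`. -/
def ConnectifierOrder (G : SimpleGraph V) (S : Set V) (X : Finset V)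
    {p q : V} (Pw : G.Walk p q) {k : ℕ} (x : Fin k → V) : Prop :=
  Function.Injective x ∧ (∀ l, x l ∈ X) ∧ (∀ z ∈ X, ∃ l, x l = z) ∧
  ∃ (s : Fin k → V) (lo hi : Fin k → ℕ),
    (∀ l, lo l ≤ hi l) ∧ (∀ l m : Fin k, l < m → hi l < lo m) ∧
    (∀ l, hi l < Pw.support.length) ∧
    (∀ (l : Fin k) (n : Fin Pw.support.length),
      G.Adj (s l) (Pw.support.get n) → lo l ≤ (n : ℕ) ∧ (n : ℕ) ≤ hi l) ∧
    ∀ l : Fin k, s l ∈ S ∧ s l ∉ Pw.support ∧ (∃ u ∈ Pw.support, G.Adj (s l) u) ∧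
      ∀ r ∈ S, G.Adj (x l) r → Reaches G (S \ {w | w ∈ Pw.support}) r (s l)

/-- `(G[S], X)` is a consistent alignment (with `G[S]` a path). -/
def ConsistentAlignmentSet (G : SimpleGraph V) (S : Set V) (X : Finset V) : Prop :=
  ∃ (p q : V) (Pw : G.Walk p q), Pw.IsPath ∧ InducedWalk G Pw ∧
    {w | w ∈ Pw.support} = S ∧ ConsistentAlignment G Pw X

/-- The orders on `X` given by `(D1, X)` and by `(G[S], X)` coincide. -/
def OrdersAgree (G : SimpleGraph V) {p q : V} (D1w : G.Walk p q)
    (S : Set V) (X : Finset V) : Prop :=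
  ∃ (k : ℕ) (x : Fin k → V),
    AlignmentOrder G D1w X x ∧
    ( (∃ (p' q' : V) (Pw : G.Walk p' q'), IsPHOf G S Pw ∧ ConnectifierOrder G S X Pw x) ∨
      (∃ (p' q' : V) (Pw : G.Walk p' q'), Pw.IsPath ∧ InducedWalk G Pw ∧
        {w | w ∈ Pw.support} = S ∧ AlignmentOrder G Pw X x) )

/-- `(D1, Y, D2)` is an `s`-trisection of `G`, where `D1` is (the support of) the path `D1w`. -/
def IsTrisection (G : SimpleGraph V) (s : ℕ) {p q : V} (D1w : G.Walk p q)
    (Y D2 : Set V) : Prop :=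
  D1w.IsPath ∧ InducedWalk G D1w ∧
  (∀ w ∈ D1w.support, w ∉ Y ∧ w ∉ D2) ∧ Disjoint Y D2 ∧
  ({w | w ∈ D1w.support} ∪ Y ∪ D2 = Set.univ) ∧
  D2.Nonempty ∧
  (∀ a ∈ D1w.support, ∀ b ∈ D2, ¬ G.Adj a b) ∧
  StableSet G Y ∧ Y.ncard = s ∧
  OpenNbhd G {w | w ∈ D1w.support} = Y ∧ OpenNbhd G D2 = Y ∧
  (∀ y ∈ Y, ∃ d ∈ D1w.support, ∀ z ∈ Y, (G.Adj d z ↔ z = y))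

/-- The conclusion of amiability for the trisection `(D1w, Y, D2)` with parameter `x`:
the pair `(G[S], X)` is "given by amiability". -/
def AmiableOutcome (G : SimpleGraph V) {p q : V} (D1w : G.Walk p q)
    (Y D2 : Set V) (x : ℕ) (S : Set V) (X : Finset V) : Prop :=
  S ⊆ D2 ∧ ↑X ⊆ Y ∧ X.card = x ∧
  ConsistentAlignment G D1w X ∧
  (IsConnectifier G S X ∨ ConsistentAlignmentSet G S X) ∧
  (¬ (IsConnectifier G S X ∧ Concentrated G S) → OrdersAgree G D1w S X)


theorem Reaches.refl {G : SimpleGraph V} {A : Set V} {u : V} (hu : u ∈ A) : Reaches G A u u :=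
  ⟨.nil, by simpa using hu⟩

theorem Reaches.symm {G : SimpleGraph V} {A : Set V} {u v : V} (h : Reaches G A u v) :
    Reaches G A v u := by
  obtain ⟨w, hw⟩ := h
  exact ⟨w.reverse, by simpa using hw⟩

theorem Reaches.trans {G : SimpleGraph V} {A : Set V} {u v x : V} (h : Reaches G A u v)
    (h' : Reaches G A v x) : Reaches G A u x := by
  obtain ⟨w, hw⟩ := h
  obtain ⟨w', hw'⟩ := h'
  refine ⟨w.append w', fun z hz => ?_⟩
  rw [Walk.mem_support_append_iff] at hz
  exact hz.elim (hw z) (hw' z)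

theorem Reaches.mono {G : SimpleGraph V} {A B : Set V} {u v : V} (h : Reaches G A u v)
    (hAB : A ⊆ B) : Reaches G B u v := by
  obtain ⟨w, hw⟩ := h
  exact ⟨w, fun z hz => hAB (hw z hz)⟩

theorem Reaches.of_adj {G : SimpleGraph V} {A : Set V} {u v : V} (h : G.Adj u v)
    (hu : u ∈ A) (hv : v ∈ A) : Reaches G A u v :=
  ⟨.cons h .nil, by simp [hu, hv]⟩

theorem support_take_subset {G : SimpleGraph V} {u v : V} (p : G.Walk u v) (n : ℕ) :
    ∀ z ∈ (p.take n).support, z ∈ p.support := by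
  intro z hz
  obtain ⟨k, hk, -⟩ := Walk.mem_support_iff_exists_getVert.mp hz
  rw [Walk.take_getVert] at hk
  exact hk ▸ Walk.getVert_mem_support _ _

theorem support_drop_subset {G : SimpleGraph V} {u v : V} (p : G.Walk u v) (n : ℕ) :
    ∀ z ∈ (p.drop n).support, z ∈ p.support := by
  intro z hz
  obtain ⟨k, hk, -⟩ := Walk.mem_support_iff_exists_getVert.mp hz
  rw [Walk.drop_getVert] at hk
  exact hk ▸ Walk.getVert_mem_support _ _

/-- Inside a set that connects `a` to `b` there is an induced path from `a` to `b`. -/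
theorem Reaches.exists_induced_path {G : SimpleGraph V} {A : Set V} {a b : V}
    (h : Reaches G A a b) :
    ∃ p : G.Walk a b, p.IsPath ∧ InducedWalk G p ∧ ∀ z ∈ p.support, z ∈ A := by
  classical
  have hex : ∃ n, ∃ p : G.Walk a b, p.length = n ∧ ∀ z ∈ p.support, z ∈ A := by
    obtain ⟨w, hw⟩ := h
    exact ⟨_, w, rfl, hw⟩
  obtain ⟨w, hwl, hw⟩ := Nat.find_spec hex
  have hmin : ∀ q : G.Walk a b, (∀ z ∈ q.support, z ∈ A) → w.length ≤ q.length := fun q hq =>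
    hwl ▸ Nat.find_min' hex ⟨q, rfl, hq⟩
  refine ⟨w.bypass, w.bypass_isPath, ?_, fun z hz => hw z (w.support_bypass_subset_support hz)⟩
  have key : ∀ i j, i < j → j ≤ w.bypass.length →
      G.Adj (w.bypass.getVert i) (w.bypass.getVert j) → j = i + 1 := by
    intro i j hij hj hadj
    have := hmin ((w.bypass.take i).append (.cons hadj (w.bypass.drop j))) (by
      intro z hz
      apply hw z
      apply w.support_bypass_subset_support
      rw [Walk.mem_support_append_iff, Walk.support_cons, List.mem_cons] at hz
      rcases hz with hz | rfl | hz
      · exact support_take_subset _ _ _ hz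
      · exact Walk.getVert_mem_support _ _
      · exact support_drop_subset _ _ _ hz)
    have h2 := w.length_bypass_le_length
    simp only [Walk.length_append, Walk.length_cons, Walk.take_length, Walk.drop_length] at this
    omega
  intro x hx y hy hadj
  obtain ⟨i, rfl, hi⟩ := Walk.mem_support_iff_exists_getVert.mp hx
  obtain ⟨j, rfl, hj⟩ := Walk.mem_support_iff_exists_getVert.mp hy
  rcases lt_trichotomy i j with hij | rfl | hij
  · obtain rfl := key i j hij hj hadj
    exact (Walk.mk_mem_edges_iff_exists _).mpr ⟨_, by omega, rfl⟩
  · exact (G.loopless.irrefl _ hadj).elim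
  · obtain rfl := key j i hij hi hadj.symm
    rw [Sym2.eq_swap]
    exact (Walk.mk_mem_edges_iff_exists _).mpr ⟨_, by omega, rfl⟩

theorem two_le_length_of_not_adj {G : SimpleGraph V} {a b : V} (p : G.Walk a b) (hne : a ≠ b)
    (hadj : ¬ G.Adj a b) : 2 ≤ p.length := by
  cases p with
  | nil => exact (hne rfl).elim
  | cons h q =>
    cases q with
    | nil => exact (hadj h).elim
    | cons h' q => simp

/-- Three pairwise disjoint and anticomplete sets, each joining the same two nonadjacent vertices,
yield a theta. -/
theorem containsTheta_of_sets {G : SimpleGraph V} {a b : V} {S₁ S₂ S₃ : Set V}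
    (hne : a ≠ b) (hadj : ¬ G.Adj a b)
    (h₁ : Reaches G (insert a (insert b S₁)) a b)
    (h₂ : Reaches G (insert a (insert b S₂)) a b)
    (h₃ : Reaches G (insert a (insert b S₃)) a b)
    (d₁₂ : Disjoint S₁ S₂) (d₁₃ : Disjoint S₁ S₃) (d₂₃ : Disjoint S₂ S₃)
    (a₁₂ : Anticomplete G S₁ S₂) (a₁₃ : Anticomplete G S₁ S₃) (a₂₃ : Anticomplete G S₂ S₃) :
    ContainsTheta G := by
  obtain ⟨p₁, hp₁, hi₁, hs₁⟩ := h₁.exists_induced_path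
  obtain ⟨p₂, hp₂, hi₂, hs₂⟩ := h₂.exists_induced_path
  obtain ⟨p₃, hp₃, hi₃, hs₃⟩ := h₃.exists_induced_path
  have int : ∀ {S : Set V} {p : G.Walk a b},
      (∀ z ∈ p.support, z ∈ insert a (insert b S)) → Interior p ⊆ S := by
    intro S p hp z hz
    rcases hp z hz.1 with h | h | h
    · exact (hz.2.1 h).elim
    · exact (hz.2.2 h).elim
    · exact h
  have i₁ := int hs₁
  have i₂ := int hs₂
  have i₃ := int hs₃
  exact ⟨a, b, p₁, p₂, p₃, hne, hadj, hp₁, hp₂, hp₃, hi₁, hi₂, hi₃,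
    two_le_length_of_not_adj _ hne hadj, two_le_length_of_not_adj _ hne hadj,
    two_le_length_of_not_adj _ hne hadj,
    d₁₂.mono i₁ i₂, d₁₃.mono i₁ i₃, d₂₃.mono i₂ i₃,
    fun x hx y hy => a₁₂ x (i₁ hx) y (i₂ hy),
    fun x hx y hy => a₁₃ x (i₁ hx) y (i₃ hy),
    fun x hx y hy => a₂₃ x (i₂ hx) y (i₃ hy)⟩

/-- Three pairwise disjoint sets joining the vertices of two triangles, with no further edges
between them, yield a prism. -/
theorem containsPrism_of_sets {G : SimpleGraph V} (a b : Fin 3 → V) (S : Fin 3 → Set V)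
    (ha : ∀ i j, i ≠ j → G.Adj (a i) (a j)) (hb : ∀ i j, i ≠ j → G.Adj (b i) (b j))
    (hr : ∀ i, Reaches G (S i) (a i) (b i))
    (hd : ∀ i j, i ≠ j → Disjoint (S i) (S j))
    (he : ∀ i j, i < j → ∀ x ∈ S i, ∀ y ∈ S j,
      G.Adj x y → (x = a i ∧ y = a j) ∨ (x = b i ∧ y = b j))
    (hl : ∀ i, i ≠ 0 → a i ≠ b i ∧ ¬ G.Adj (a i) (b i)) :
    ContainsPrism G := by
  choose p hp hi hs using fun i => (hr i).exists_induced_path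
  refine ⟨a, b, p, ha, hb, hp, hi, ?_, ?_, ?_⟩
  · intro i j hij x hx hx'
    exact Set.disjoint_left.mp (hd i j hij) (hs i x hx) (hs j x hx')
  · intro i j hij x hx y hy hxy
    rcases lt_or_gt_of_ne hij with h | h
    · exact he i j h x (hs i x hx) y (hs j y hy) hxy
    · have := he j i h y (hs j y hy) x (hs i x hx) hxy.symm
      tauto
  · intro i j hij
    have hlen : ∀ i, i ≠ 0 → 2 ≤ (p i).length := fun i h =>
      two_le_length_of_not_adj _ (hl i h).1 (hl i h).2
    by_cases h : i = 0
    · have := hlen j (by rintro rfl; exact hij h)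
      omega
    · have := hlen i h
      omega

/-- `f` runs periodically around a hole of length `n`. -/
structure IsHoleParam (G : SimpleGraph V) (n : ℤ) (f : ℤ → V) : Prop where
  four_le : 4 ≤ n
  eq_iff : ∀ i j, f i = f j ↔ n ∣ j - i
  adj_iff : ∀ i j, G.Adj (f i) (f j) ↔ n ∣ j - i - 1 ∨ n ∣ j - i + 1

/-- The vertices of a hole with indices from `s` to `t`. -/
def Arc (f : ℤ → V) (s t : ℤ) : Set V := f '' Set.Icc s t

theorem mem_arc {f : ℤ → V} {s t i : ℤ} (hs : s ≤ i) (ht : i ≤ t) : f i ∈ Arc f s t :=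
  ⟨i, ⟨hs, ht⟩, rfl⟩

namespace IsHoleParam

variable {G : SimpleGraph V} {n : ℤ} {f : ℤ → V}

theorem add_period (hf : IsHoleParam G n f) (i : ℤ) : f (i + n) = f i :=
  ((hf.eq_iff _ _).mpr (by simp)).symm

theorem shift (hf : IsHoleParam G n f) (k : ℤ) : IsHoleParam G n (fun i => f (i + k)) :=
  ⟨hf.four_le, fun i j => by rw [hf.eq_iff]; ring_nf, fun i j => by rw [hf.adj_iff]; ring_nf⟩

theorem reflect (hf : IsHoleParam G n f) : IsHoleParam G n (fun i => f (-i)) :=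
  ⟨hf.four_le, fun i j => by rw [hf.eq_iff, ← dvd_neg]; ring_nf,
    fun i j => by rw [hf.adj_iff, or_comm, ← dvd_neg, ← dvd_neg (b := -j - -i - 1)]; ring_nf⟩

theorem ne (hf : IsHoleParam G n f) {i j : ℤ} (h : i < j) (h' : j < i + n) : f i ≠ f j := by
  intro he
  have := Int.le_of_dvd (by omega) ((hf.eq_iff _ _).mp he)
  omega

theorem adj_succ (hf : IsHoleParam G n f) (i : ℤ) : G.Adj (f i) (f (i + 1)) := by
  rw [hf.adj_iff]; left; simp

theorem adj_of_eq (hf : IsHoleParam G n f) {i j : ℤ} (h : j = i + 1) : G.Adj (f i) (f j) :=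
  h ▸ hf.adj_succ i

theorem not_adj (hf : IsHoleParam G n f) {i j : ℤ} (h : i + 2 ≤ j) (h' : j + 2 ≤ i + n) :
    ¬ G.Adj (f i) (f j) := by
  intro he
  rcases (hf.adj_iff _ _).mp he with h1 | h1
  · have := Int.le_of_dvd (by omega) h1
    omega
  · have := Int.le_of_dvd (by omega) h1
    omega

theorem reaches_arc (hf : IsHoleParam G n f) {s t i j : ℤ} (hi : i ∈ Set.Icc s t)
    (hj : j ∈ Set.Icc s t) : Reaches G (Arc f s t) (f i) (f j) := by
  have key : ∀ k : ℕ, s + k ≤ t → Reaches G (Arc f s t) (f s) (f (s + k)) := by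
    intro k
    induction k with
    | zero => intro h; simpa using Reaches.refl (mem_arc le_rfl (by simpa using h))
    | succ k ih =>
      intro h
      push_cast at h ⊢
      exact (ih (by omega)).trans (.of_adj (hf.adj_of_eq (by ring))
        (mem_arc (by omega) (by omega)) (mem_arc (by omega) (by omega)))
  have key' : ∀ i ∈ Set.Icc s t, Reaches G (Arc f s t) (f s) (f i) := by
    intro i hi
    obtain ⟨k, hk⟩ := Int.le.dest hi.1
    have := key k (by have := hi.2; omega)
    rwa [hk] at this
  exact (key' i hi).symm.trans (key' j hj)

theorem reaches_via_arc (hf : IsHoleParam G n f) {s t i j : ℤ} {a b : V} {S : Set V}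
    (hi : i ∈ Set.Icc s t) (hj : j ∈ Set.Icc s t) (ha : G.Adj a (f i)) (hb : G.Adj b (f j))
    (haS : a ∈ S) (hbS : b ∈ S) (hS : Arc f s t ⊆ S) :
    Reaches G S a b :=
  ((Reaches.of_adj ha haS (hS ⟨i, hi, rfl⟩)).trans ((hf.reaches_arc hi hj).mono hS)).trans
    (.of_adj hb.symm (hS ⟨j, hj, rfl⟩) hbS)

/-- Two vertices joined through two separated arcs of a hole, and through a set that is
anticomplete to both arcs, are the ends of a theta. -/
theorem containsTheta_of_two_arcs (hf : IsHoleParam G n f) {a b : V} (hne : a ≠ b)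
    (hadj : ¬ G.Adj a b) {s₁ t₁ s₂ t₂ i₁ j₁ i₂ j₂ : ℤ} (h₁₂ : t₁ + 2 ≤ s₂) (h₂₁ : t₂ + 2 ≤ s₁ + n)
    (hi₁ : i₁ ∈ Set.Icc s₁ t₁) (hj₁ : j₁ ∈ Set.Icc s₁ t₁)
    (hi₂ : i₂ ∈ Set.Icc s₂ t₂) (hj₂ : j₂ ∈ Set.Icc s₂ t₂)
    (ha₁ : G.Adj a (f i₁)) (hb₁ : G.Adj b (f j₁)) (ha₂ : G.Adj a (f i₂)) (hb₂ : G.Adj b (f j₂))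
    {S : Set V} (hr : Reaches G (insert a (insert b S)) a b)
    (hS : ∀ x ∈ S, ∀ t, t ∈ Set.Icc s₁ t₁ ∨ t ∈ Set.Icc s₂ t₂ → f t ≠ x ∧ ¬ G.Adj x (f t)) :
    ContainsTheta G := by
  have sub : ∀ s t : ℤ, Arc f s t ⊆ insert a (insert b (Arc f s t)) :=
    fun s t x hx => Or.inr (Or.inr hx)
  refine containsTheta_of_sets hne hadj
    (hf.reaches_via_arc hi₁ hj₁ ha₁ hb₁ (by simp) (by simp) (sub _ _))
    (hf.reaches_via_arc hi₂ hj₂ ha₂ hb₂ (by simp) (by simp) (sub _ _)) hr ?_ ?_ ?_ ?_ ?_ ?_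
  · rw [Set.disjoint_left]
    rintro _ ⟨i, ⟨hi, hi'⟩, rfl⟩ ⟨j, ⟨hj, hj'⟩, h⟩
    exact hf.ne (by omega) (by omega) h.symm
  · rw [Set.disjoint_left]
    rintro _ ⟨i, hi, rfl⟩ h
    exact (hS _ h i (Or.inl hi)).1 rfl
  · rw [Set.disjoint_left]
    rintro _ ⟨i, hi, rfl⟩ h
    exact (hS _ h i (Or.inr hi)).1 rfl
  · rintro _ ⟨i, ⟨hi, hi'⟩, rfl⟩ _ ⟨j, ⟨hj, hj'⟩, rfl⟩
    exact hf.not_adj (by omega) (by omega)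
  · rintro _ ⟨i, hi, rfl⟩ x hx h
    exact (hS _ hx i (Or.inl hi)).2 h.symm
  · rintro _ ⟨i, hi, rfl⟩ x hx h
    exact (hS _ hx i (Or.inr hi)).2 h.symm

end IsHoleParam

/-- A connected set `M` attaching to a hole and joining two of its parts: the vertex `d` attaches
to the arc from `p` to `p'`, the vertex `e` to the arc from `q` to `q'`, and nothing else in `M`
attaches to the hole; moreover `c` is a further vertex with no neighbor in `M`. -/
structure IsBridge (G : SimpleGraph V) (f : ℤ → V) (c : V) (M : Set V) (d e : V)
    (p p' q q' : ℤ) : Prop where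
  notMem_hole : ∀ t, f t ∉ M
  center_hole : ∀ t, f t ≠ c
  center_notMem : c ∉ M
  center_not_adj : ∀ m ∈ M, ¬ G.Adj m c
  left_mem : d ∈ M
  right_mem : e ∈ M
  reaches : Reaches G M d e
  adj_p : G.Adj d (f p)
  adj_p' : G.Adj d (f p')
  adj_q : G.Adj e (f q)
  adj_q' : G.Adj e (f q')
  attach : ∀ m ∈ M, ∀ t, G.Adj m (f t) → (m = d ∧ f t ∈ Arc f p p') ∨ (m = e ∧ f t ∈ Arc f q q')

namespace IsBridge

variable {G : SimpleGraph V} {n : ℤ} {f : ℤ → V} {c d e : V} {M : Set V} {p p' q q' : ℤ}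

theorem reflect (hB : IsBridge G f c M d e p p' q q') :
    IsBridge G (fun i => f (-i)) c M e d (-q') (-q) (-p') (-p) where
  notMem_hole t := hB.notMem_hole _
  center_hole t := hB.center_hole _
  center_notMem := hB.center_notMem
  center_not_adj := hB.center_not_adj
  left_mem := hB.right_mem
  right_mem := hB.left_mem
  reaches := hB.reaches.symm
  adj_p := by simpa using hB.adj_q'
  adj_p' := by simpa using hB.adj_q
  adj_q := by simpa using hB.adj_p'
  adj_q' := by simpa using hB.adj_p
  attach m hm t h := by
    rcases hB.attach m hm _ h with ⟨h1, i, ⟨hi, hi'⟩, h2⟩ | ⟨h1, i, ⟨hi, hi'⟩, h2⟩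
    · exact Or.inr ⟨h1, -i, ⟨by omega, by omega⟩, by simpa using h2⟩
    · exact Or.inl ⟨h1, -i, ⟨by omega, by omega⟩, by simpa using h2⟩

theorem swap (hB : IsBridge G f c M d e p p' q q') (hf : IsHoleParam G n f) :
    IsBridge G f c M e d q q' (p + n) (p' + n) where
  notMem_hole := hB.notMem_hole
  center_hole := hB.center_hole
  center_notMem := hB.center_notMem
  center_not_adj := hB.center_not_adj
  left_mem := hB.right_mem
  right_mem := hB.left_mem
  reaches := hB.reaches.symm
  adj_p := hB.adj_q
  adj_p' := hB.adj_q'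
  adj_q := by rw [hf.add_period]; exact hB.adj_p
  adj_q' := by rw [hf.add_period]; exact hB.adj_p'
  attach m hm t h := by
    rcases hB.attach m hm _ h with ⟨h1, i, ⟨hi, hi'⟩, h2⟩ | ⟨h1, h2⟩
    · exact Or.inr ⟨h1, i + n, ⟨by omega, by omega⟩, by rw [hf.add_period]; exact h2⟩
    · exact Or.inl ⟨h1, h2⟩

theorem not_adj (hB : IsBridge G f c M d e p p' q q') (hf : IsHoleParam G n f) {m : V} (hm : m ∈ M)
    {t : ℤ} (h₁ : m = d → (p' < t ∧ t < p + n) ∨ (p' < t + n ∧ t < p))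
    (h₂ : m = e → (q' < t ∧ t < q + n) ∨ (q' < t + n ∧ t < q)) : ¬ G.Adj m (f t) := by
  intro h
  have key : ∀ r r', (r' < t ∧ t < r + n) ∨ (r' < t + n ∧ t < r) → f t ∉ Arc f r r' := by
    rintro r r' hr ⟨i, ⟨hi, hi'⟩, hit⟩
    rcases hr with hr | hr
    · exact hf.ne (by omega) (by omega) hit
    · exact hf.ne (by omega) (by omega) hit.symm
  rcases hB.attach m hm t h with ⟨h3, h4⟩ | ⟨h3, h4⟩
  · exact key _ _ (h₁ h3) h4
  · exact key _ _ (h₂ h3) h4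

theorem containsTheta_of_single_single (hB : IsBridge G f c M d e p p q q) (hf : IsHoleParam G n f)
    (hpq : p + 2 ≤ q) (hqp : q + 2 ≤ p + n) : ContainsTheta G := by
  refine hf.containsTheta_of_two_arcs (hf.ne (i := p) (j := q) (by omega) (by omega))
    (hf.not_adj (by omega) (by omega)) (s₁ := p + 1) (t₁ := q - 1) (s₂ := q + 1)
    (t₂ := p + n - 1) (by omega) (by omega) (i₁ := p + 1) (j₁ := q - 1) (i₂ := p + n - 1)
    (j₂ := q + 1) ⟨by omega, by omega⟩ ⟨by omega, by omega⟩ ⟨by omega, by omega⟩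
    ⟨by omega, by omega⟩ (hf.adj_succ _) (hf.adj_of_eq (by ring)).symm ?_
    (hf.adj_succ _) (S := M) ?_ ?_
  · rw [← hf.add_period]
    exact (hf.adj_of_eq (by ring)).symm
  · have hsub : M ⊆ insert (f p) (insert (f q) M) := fun x hx => Or.inr (Or.inr hx)
    exact ((Reaches.of_adj hB.adj_p.symm (by simp) (hsub hB.left_mem)).trans
      (hB.reaches.mono hsub)).trans (.of_adj hB.adj_q (hsub hB.right_mem) (by simp))
  · intro x hx t ht
    refine ⟨fun h => hB.notMem_hole t (h ▸ hx), hB.not_adj hf hx (fun _ => ?_) fun _ => ?_⟩ <;>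
    rcases ht with ⟨ht, ht'⟩ | ⟨ht, ht'⟩ <;> omega

theorem containsPrism_of_edge_edge (hB : IsBridge G f c M d e p (p + 1) q (q + 1))
    (hf : IsHoleParam G n f) (hpq : p + 3 ≤ q) (hqp : q + 3 ≤ p + n) : ContainsPrism G := by
  refine containsPrism_of_sets ![d, f (p + 1), f p] ![e, f q, f (q + 1)]
    ![M, Arc f (p + 1) q, Arc f (q + 1) (p + n)] ?_ ?_ ?_ ?_ ?_ ?_
  · have h1 := hB.adj_p
    have h2 := hB.adj_p'
    have h3 := hf.adj_succ p
    intro i j hij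
    fin_cases i <;> fin_cases j <;> simp_all [SimpleGraph.adj_comm]
  · have h1 := hB.adj_q
    have h2 := hB.adj_q'
    have h3 := hf.adj_succ q
    intro i j hij
    fin_cases i <;> fin_cases j <;> simp_all [SimpleGraph.adj_comm]
  · intro i
    fin_cases i
    · exact hB.reaches
    · exact hf.reaches_arc ⟨by omega, by omega⟩ ⟨by omega, by omega⟩
    · simpa [hf.add_period] using hf.reaches_arc (s := q + 1) (t := p + n) (i := p + n)
        (j := q + 1) ⟨by omega, by omega⟩ ⟨by omega, by omega⟩
  · have h1 : ∀ s t, Disjoint M (Arc f s t) := by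
      intro s t
      rw [Set.disjoint_right]
      rintro _ ⟨i, -, rfl⟩
      exact hB.notMem_hole i
    have h2 : Disjoint (Arc f (p + 1) q) (Arc f (q + 1) (p + n)) := by
      rw [Set.disjoint_left]
      rintro _ ⟨i, ⟨hi, hi'⟩, rfl⟩ ⟨j, ⟨hj, hj'⟩, h⟩
      exact hf.ne (by omega) (by omega) h.symm
    intro i j hij
    fin_cases i <;> fin_cases j
    all_goals first
      | exact (hij rfl).elim
      | exact h1 _ _
      | exact (h1 _ _).symm
      | exact h2
      | exact h2.symm
  · have h1 : ∀ m ∈ M, ∀ t, p ≤ t → t ≤ p + n → G.Adj m (f t) →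
        (m = d ∧ (t = p ∨ t = p + 1 ∨ t = p + n)) ∨ (m = e ∧ (t = q ∨ t = q + 1)) := by
      intro m hm t ht ht' h
      by_contra hcon
      exact hB.not_adj hf hm (t := t) (by intro h; simp [h] at hcon; omega)
        (by intro h; simp [h] at hcon; omega) h
    intro i j hij x hx y hy hxy
    fin_cases i <;> fin_cases j
    all_goals try exact absurd hij (by decide)
    · obtain ⟨t, ⟨ht, ht'⟩, rfl⟩ := hy
      rcases h1 x hx t (by omega) (by omega) hxy with ⟨h2, h3⟩ | ⟨h2, h3⟩
      · left
        obtain rfl : t = p + 1 := by omega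
        exact ⟨h2, rfl⟩
      · right
        obtain rfl : t = q := by omega
        exact ⟨h2, rfl⟩
    · obtain ⟨t, ⟨ht, ht'⟩, rfl⟩ := hy
      rcases h1 x hx t (by omega) (by omega) hxy with ⟨h2, h3⟩ | ⟨h2, h3⟩
      · left
        obtain rfl : t = p + n := by omega
        exact ⟨h2, hf.add_period p⟩
      · right
        obtain rfl : t = q + 1 := by omega
        exact ⟨h2, rfl⟩
    · obtain ⟨t, ⟨ht, ht'⟩, rfl⟩ := hy
      obtain ⟨s, ⟨hs, hs'⟩, rfl⟩ := hx
      by_cases h2 : s + 2 ≤ t ∧ t + 2 ≤ s + n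
      · exact (hf.not_adj h2.1 h2.2 hxy).elim
      · by_cases h3 : s = q
        · right
          obtain rfl : t = q + 1 := by omega
          exact ⟨congrArg f h3, rfl⟩
        · left
          obtain rfl : t = p + n := by omega
          obtain rfl : s = p + 1 := by omega
          exact ⟨rfl, hf.add_period p⟩
  · intro i hi
    fin_cases i
    · exact (hi rfl).elim
    · exact ⟨hf.ne (by omega) (by omega), hf.not_adj (by omega) (by omega)⟩
    · have h1 := hf.ne (i := q + 1) (j := p + n) (by omega) (by omega)
      have h2 := hf.not_adj (i := q + 1) (j := p + n) (by omega) (by omega)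
      rw [hf.add_period] at h1 h2
      exact ⟨h1.symm, fun h => h2 h.symm⟩

theorem containsTheta_of_not_edge (hB : IsBridge G f c M d e p p' q q') (hf : IsHoleParam G n f)
    {x₁ x₂ y₁ y₂ : ℤ} (h₁ : x₁ < p) (h₂ : p ≤ p') (h₃ : p' < x₂) (h₄ : x₂ + 2 ≤ y₁) (h₅ : y₁ < q)
    (h₆ : q < q') (h₇ : q' < y₂) (h₈ : y₂ ≤ x₁ + n) (hpp : p' ≠ p + 1)
    (cx₁ : G.Adj c (f x₁)) (cx₂ : G.Adj c (f x₂)) (cy₁ : G.Adj c (f y₁)) (cp : ¬ G.Adj c (f p)) :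
    ContainsTheta G := by
  rcases h₂.eq_or_lt with rfl | h₂
  · refine hf.containsTheta_of_two_arcs (hB.center_hole p) (fun h => cp h.symm)
      (s₁ := x₁) (t₁ := p - 1) (s₂ := p + 1) (t₂ := x₂) (by omega) (by omega)
      (i₁ := p - 1) (j₁ := x₁) (i₂ := p + 1) (j₂ := x₂) ⟨by omega, by omega⟩ ⟨by omega, by omega⟩
      ⟨by omega, by omega⟩ ⟨by omega, by omega⟩ (hf.adj_of_eq (by ring)).symm cx₁
      (hf.adj_succ _) cx₂ (S := M ∪ Arc f y₁ q) ?_ ?_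
    · have hsub : M ⊆ insert (f p) (insert c (M ∪ Arc f y₁ q)) :=
        fun x hx => Or.inr (Or.inr (Or.inl hx))
      exact ((Reaches.of_adj hB.adj_p.symm (by simp) (hsub hB.left_mem)).trans
        (hB.reaches.mono hsub)).trans
        (hf.reaches_via_arc (s := y₁) (t := q) (i := q) (j := y₁) ⟨by omega, by omega⟩
          ⟨by omega, by omega⟩ hB.adj_q cy₁ (hsub hB.right_mem) (by simp)
          fun x hx => Or.inr (Or.inr (Or.inr hx)))
    · rintro x (hx | ⟨i, ⟨hi, hi'⟩, rfl⟩) t ht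
      · refine ⟨fun h => hB.notMem_hole t (h ▸ hx), hB.not_adj hf hx (fun _ => ?_) fun _ => ?_⟩ <;>
        rcases ht with ⟨ht, ht'⟩ | ⟨ht, ht'⟩ <;> omega
      · have ht : x₁ ≤ t ∧ t ≤ x₂ := by rcases ht with ⟨ht, ht'⟩ | ⟨ht, ht'⟩ <;> omega
        exact ⟨hf.ne (by omega) (by omega),
          fun h => hf.not_adj (by omega) (by omega) h.symm⟩
  · refine hf.containsTheta_of_two_arcs (a := d) (b := c)
      (fun h => hB.center_notMem (h ▸ hB.left_mem)) (hB.center_not_adj _ hB.left_mem)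
      (s₁ := x₁) (t₁ := p) (s₂ := p') (t₂ := x₂) (by omega) (by omega)
      (i₁ := p) (j₁ := x₁) (i₂ := p') (j₂ := x₂) ⟨by omega, by omega⟩ ⟨by omega, by omega⟩
      ⟨by omega, by omega⟩ ⟨by omega, by omega⟩ hB.adj_p cx₁
      hB.adj_p' cx₂ (S := (M \ {d}) ∪ Arc f y₁ q) ?_ ?_
    · have hsub : M ⊆ insert d (insert c ((M \ {d}) ∪ Arc f y₁ q)) := by
        intro x hx
        by_cases h : x = d
        · exact Or.inl h
        · exact Or.inr (Or.inr (Or.inl ⟨hx, h⟩))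
      exact (hB.reaches.mono hsub).trans
        (hf.reaches_via_arc (s := y₁) (t := q) (i := q) (j := y₁) ⟨by omega, by omega⟩
          ⟨by omega, by omega⟩ hB.adj_q cy₁ (hsub hB.right_mem) (by simp)
          fun x hx => Or.inr (Or.inr (Or.inr hx)))
    · rintro x (hx | ⟨i, ⟨hi, hi'⟩, rfl⟩) t ht
      · refine ⟨fun h => hB.notMem_hole t (h ▸ hx.1),
          hB.not_adj hf hx.1 (fun h => (hx.2 h).elim) fun _ => ?_⟩
        rcases ht with ⟨ht, ht'⟩ | ⟨ht, ht'⟩ <;> omega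
      · have ht : x₁ ≤ t ∧ t ≤ x₂ := by rcases ht with ⟨ht, ht'⟩ | ⟨ht, ht'⟩ <;> omega
        exact ⟨hf.ne (by omega) (by omega),
          fun h => hf.not_adj (by omega) (by omega) h.symm⟩

theorem containsTheta_or_containsPrism_of_gap (hB : IsBridge G f c M d e p p' q q')
    (hf : IsHoleParam G n f) {x₁ x₂ y₁ y₂ : ℤ} (h₁ : x₁ < p) (h₂ : p ≤ p') (h₃ : p' < x₂)
    (h₄ : x₂ + 2 ≤ y₁) (h₅ : y₁ < q) (h₆ : q ≤ q') (h₇ : q' < y₂) (h₈ : y₂ ≤ x₁ + n)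
    (cx₁ : G.Adj c (f x₁)) (cx₂ : G.Adj c (f x₂)) (cy₁ : G.Adj c (f y₁)) (cy₂ : G.Adj c (f y₂))
    (cp : ¬ G.Adj c (f p)) (cq' : ¬ G.Adj c (f q')) : ContainsTheta G ∨ ContainsPrism G := by
  by_cases hp : p' = p + 1
  · subst hp
    by_cases hq : q' = q + 1
    · subst hq
      exact Or.inr (hB.containsPrism_of_edge_edge hf (by omega) (by omega))
    · exact Or.inl (hB.reflect.containsTheta_of_not_edge hf.reflect (x₁ := -y₂) (x₂ := -y₁)
        (y₁ := -x₂) (y₂ := -x₁) (by omega) (by omega) (by omega) (by omega) (by omega) (by omega)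
        (by omega) (by omega) (by omega) (by simpa) (by simpa) (by simpa) (by simpa))
  · by_cases hq : q < q'
    · exact Or.inl (hB.containsTheta_of_not_edge hf h₁ h₂ h₃ h₄ h₅ hq h₇ h₈ hp cx₁ cx₂ cy₁ cp)
    · obtain rfl : q = q' := by omega
      by_cases hpp : p = p'
      · subst hpp
        exact Or.inl (hB.containsTheta_of_single_single hf (by omega) (by omega))
      · exact Or.inl (hB.reflect.containsTheta_of_not_edge hf.reflect (x₁ := -y₂) (x₂ := -y₁)
          (y₁ := -x₂) (y₂ := -x₁) (by omega) (by omega) (by omega) (by omega) (by omega)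
          (by omega) (by omega) (by omega) (by omega) (by simpa) (by simpa) (by simpa) (by simpa))

end IsBridge

theorem exists_extremes {P : ℤ → Prop} {x y : ℤ} (h : ∃ t, x < t ∧ t < y ∧ P t) :
    ∃ p p', x < p ∧ p ≤ p' ∧ p' < y ∧ P p ∧ P p' ∧ ∀ t, x < t → t < y → P t → p ≤ t ∧ t ≤ p' := by
  obtain ⟨p, ⟨hp₁, hp₂, hp₃⟩, hp⟩ := Int.exists_least_of_bdd
    (P := fun t => x < t ∧ t < y ∧ P t) ⟨x, fun z hz => hz.1.le⟩ h
  obtain ⟨p', ⟨hp₁', hp₂', hp₃'⟩, hp'⟩ := Int.exists_greatest_of_bdd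
    (P := fun t => x < t ∧ t < y ∧ P t) ⟨y, fun z hz => hz.2.1.le⟩ h
  exact ⟨p, p', hp₁, hp _ ⟨hp₁', hp₂', hp₃'⟩, hp₂', hp₃, hp₃',
    fun t h₁ h₂ h₃ => ⟨hp t ⟨h₁, h₂, h₃⟩, hp' t ⟨h₁, h₂, h₃⟩⟩⟩

/-- The indices `x < y` bound a sector of the wheel with center `c`. -/
structure IsSectorParam (G : SimpleGraph V) (f : ℤ → V) (c : V) (x y : ℤ) : Prop where
  lt : x < y
  left : G.Adj c (f x)
  right : G.Adj c (f y)
  not_adj : ∀ t, x < t → t < y → ¬ G.Adj c (f t)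

/-- A non-special wheel with center `c` whose hole is parametrized by `f`. -/
structure IsWheelParam (G : SimpleGraph V) (n : ℤ) (f : ℤ → V) (c : V) : Prop
    extends IsHoleParam G n f where
  center : ∀ t, f t ≠ c
  three_nbrs : ∀ i j, ∃ t, G.Adj c (f t) ∧ f t ≠ f i ∧ f t ≠ f j
  not_special : ∀ i j, G.Adj c (f i) → G.Adj c (f (i + 1)) → G.Adj c (f j) → i + 3 ≤ j →
    j + 2 ≤ i + n → ∃ t, G.Adj c (f t) ∧ f t ≠ f i ∧ f t ≠ f (i + 1) ∧ f t ≠ f j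

theorem IsHoleParam.exists_representative {G : SimpleGraph V} {n : ℤ} {f : ℤ → V}
    (hf : IsHoleParam G n f) (x t : ℤ) : ∃ s, x ≤ s ∧ s < x + n ∧ f s = f t := by
  have h4 := hf.four_le
  refine ⟨x + (t - x) % n, ?_, ?_, ?_⟩
  · have := Int.emod_nonneg (t - x) (b := n) (by omega)
    omega
  · have := Int.emod_lt_of_pos (t - x) (b := n) (by omega)
    omega
  · rw [hf.eq_iff]
    refine ⟨(t - x) / n, ?_⟩
    have := Int.emod_add_mul_ediv (t - x) n
    linarith

namespace IsWheelParam

variable {G : SimpleGraph V} {n : ℤ} {f : ℤ → V} {c d e : V} {M : Set V}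
variable {x₁ x₂ y₁ y₂ z₁ z₂ p q r : ℤ}

theorem gap_or_gap (hw : IsWheelParam G n f c) (hpr : ¬ ContainsPrism G)
    (hx : IsSectorParam G f c x₁ x₂) (hy : IsSectorParam G f c y₁ y₂)
    (hx₂ : x₁ + 2 ≤ x₂) (hy₂ : y₁ + 2 ≤ y₂) (hxy : x₂ ≤ y₁) (hyx : y₂ ≤ x₁ + n) :
    x₂ + 2 ≤ y₁ ∨ y₂ + 2 ≤ x₁ + n := by
  by_contra! hcon
  have hf := hw.toIsHoleParam
  have hper := hf.add_period x₁
  have nbr : ∀ t, G.Adj c (f t) → f t = f x₁ ∨ f t = f x₂ ∨ f t = f y₁ ∨ f t = f y₂ := by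
    intro t ht
    obtain ⟨s, hs, hs', hst⟩ := hf.exists_representative x₁ t
    rw [← hst] at ht ⊢
    have h1 : ¬ (x₁ < s ∧ s < x₂) := fun h => hx.not_adj s h.1 h.2 ht
    have h2 : ¬ (y₁ < s ∧ s < y₂) := fun h => hy.not_adj s h.1 h.2 ht
    have h3 : s = x₁ ∨ s = x₂ ∨ s = y₁ ∨ s = y₂ := by omega
    rcases h3 with rfl | rfl | rfl | rfl <;> simp
  have three := hw.three_nbrs
  have special := hw.not_special
  rcases hxy.eq_or_lt with rfl | hxy
  · rcases hyx.eq_or_lt with rfl | hyx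
    · obtain ⟨t, h1, h2, h3⟩ := three x₁ x₂
      have := nbr t h1
      simp_all
    · have hlast : y₂ + 1 = x₁ + n := by omega
      obtain ⟨t, h1, h2, h3, h4⟩ := special y₂ (x₂ + n) hy.right (by rw [hlast, hper]; exact hx.left)
        (by rw [hf.add_period]; exact hx.right) (by omega) (by omega)
      rw [hlast, hper] at h3
      rw [hf.add_period] at h4
      have := nbr t h1
      tauto
  · obtain rfl : y₁ = x₂ + 1 := by omega
    rcases hyx.eq_or_lt with rfl | hyx
    · obtain ⟨t, h1, h2, h3, h4⟩ := special x₂ (x₁ + n) hx.right hy.left hy.right (by omega)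
        (by omega)
      rw [hper] at *
      have := nbr t h1
      tauto
    · have hlast : y₂ + 1 = x₁ + n := by omega
      have hadj : G.Adj (f y₂) (f x₁) := by
        rw [← hper]; exact hf.adj_of_eq hlast.symm
      have hadj' := hf.adj_succ x₂
      have h1 := hx.left
      have h2 := hx.right
      have h3 := hy.left
      have h4 := hy.right
      have hc : ∀ s t, Disjoint {c} (Arc f s t) := by
        intro s t
        rw [Set.disjoint_right]
        rintro _ ⟨i, -, rfl⟩ h
        exact hw.center i h
      have ha : Disjoint (Arc f x₁ x₂) (Arc f (x₂ + 1) y₂) := by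
        rw [Set.disjoint_left]
        rintro _ ⟨i, ⟨hi, hi'⟩, rfl⟩ ⟨j, ⟨hj, hj'⟩, h⟩
        exact hf.ne (by omega) (by omega) h.symm
      apply hpr
      refine containsPrism_of_sets ![c, f x₂, f (x₂ + 1)] ![c, f x₁, f y₂]
        ![{c}, Arc f x₁ x₂, Arc f (x₂ + 1) y₂] ?_ ?_ ?_ ?_ ?_ ?_
      · intro i j hij
        fin_cases i <;> fin_cases j <;> simp_all [SimpleGraph.adj_comm]
      · intro i j hij
        fin_cases i <;> fin_cases j <;> simp_all [SimpleGraph.adj_comm]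
      · intro i
        fin_cases i
        · exact Reaches.refl rfl
        · exact hf.reaches_arc ⟨by omega, by omega⟩ ⟨by omega, by omega⟩
        · exact hf.reaches_arc ⟨by omega, by omega⟩ ⟨by omega, by omega⟩
      · intro i j hij
        fin_cases i <;> fin_cases j
        all_goals first
          | exact (hij rfl).elim
          | exact hc _ _
          | exact (hc _ _).symm
          | exact ha
          | exact ha.symm
      · intro i j hij x hx' y hy' hxy'
        fin_cases i <;> fin_cases j
        all_goals try exact absurd hij (by decide)
        · obtain rfl : x = c := hx'
          obtain ⟨t, ⟨ht, ht'⟩, rfl⟩ := hy'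
          have h5 : ¬ (x₁ < t ∧ t < x₂) := fun h => hx.not_adj t h.1 h.2 hxy'
          rcases (by omega : t = x₂ ∨ t = x₁) with rfl | rfl
          · exact Or.inl ⟨rfl, rfl⟩
          · exact Or.inr ⟨rfl, rfl⟩
        · obtain rfl : x = c := hx'
          obtain ⟨t, ⟨ht, ht'⟩, rfl⟩ := hy'
          have h5 : ¬ (x₂ + 1 < t ∧ t < y₂) := fun h => hy.not_adj t h.1 h.2 hxy'
          rcases (by omega : t = x₂ + 1 ∨ t = y₂) with rfl | rfl
          · exact Or.inl ⟨rfl, rfl⟩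
          · exact Or.inr ⟨rfl, rfl⟩
        · obtain ⟨s, ⟨hs, hs'⟩, rfl⟩ := hx'
          obtain ⟨t, ⟨ht, ht'⟩, rfl⟩ := hy'
          by_cases h5 : s + 2 ≤ t ∧ t + 2 ≤ s + n
          · exact (hf.not_adj h5.1 h5.2 hxy').elim
          · by_cases h6 : s = x₂
            · left
              obtain rfl : t = x₂ + 1 := by omega
              exact ⟨congrArg f h6, rfl⟩
            · right
              obtain rfl : t = y₂ := by omega
              obtain rfl : s = x₁ := by omega
              exact ⟨rfl, rfl⟩
      · intro i hi
        fin_cases i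
        · exact (hi rfl).elim
        · exact ⟨(hf.ne (i := x₁) (j := x₂) (by omega) (by omega)).symm,
            fun h => hf.not_adj (i := x₁) (j := x₂) (by omega) (by omega) h.symm⟩
        · exact ⟨hf.ne (by omega) (by omega), hf.not_adj (by omega) (by omega)⟩

/-- A connected set joining the interiors of two sectors, and attaching to the hole only through
one vertex for each of these, cannot exist in a (theta, prism)-free graph. -/
theorem containsTheta_or_containsPrism_of_two_sectors (hw : IsWheelParam G n f c)
    (hx : IsSectorParam G f c x₁ x₂) (hy : IsSectorParam G f c y₁ y₂)
    (hxy : x₂ ≤ y₁) (hyx : y₂ ≤ x₁ + n) (hMf : ∀ t, f t ∉ M) (hcM : c ∉ M)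
    (hMc : ∀ m ∈ M, ¬ G.Adj m c) (hd : d ∈ M) (he : e ∈ M) (hr : Reaches G M d e)
    (hdx : ∃ t, x₁ < t ∧ t < x₂ ∧ G.Adj d (f t)) (hey : ∃ t, y₁ < t ∧ t < y₂ ∧ G.Adj e (f t))
    (hatt : ∀ m ∈ M, ∀ t, G.Adj m (f t) → (m = d ∧ ∃ s, x₁ < s ∧ s < x₂ ∧ f s = f t) ∨
      (m = e ∧ ∃ s, y₁ < s ∧ s < y₂ ∧ f s = f t)) :
    ContainsTheta G ∨ ContainsPrism G := by
  by_contra! hcon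
  obtain ⟨p, p', hp₁, hp₂, hp₃, hp, hp', hpm⟩ := exists_extremes hdx
  obtain ⟨q, q', hq₁, hq₂, hq₃, hq, hq', hqm⟩ := exists_extremes hey
  have hf := hw.toIsHoleParam
  have hB : IsBridge G f c M d e p p' q q' := by
    refine ⟨hMf, hw.center, hcM, hMc, hd, he, hr, hp, hp', hq, hq', fun m hm t ht => ?_⟩
    rcases hatt m hm t ht with ⟨rfl, s, hs, hs', hst⟩ | ⟨rfl, s, hs, hs', hst⟩ <;>
    rw [← hst] at ht ⊢
    · exact Or.inl ⟨rfl, s, hpm s hs hs' ht, rfl⟩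
    · exact Or.inr ⟨rfl, s, hqm s hs hs' ht, rfl⟩
  rcases hw.gap_or_gap hcon.2 hx hy (by omega) (by omega) hxy hyx with hg | hg
  · exact (hB.containsTheta_or_containsPrism_of_gap hf hp₁ hp₂ hp₃ hg hq₁ hq₂ hq₃ hyx hx.left
      hx.right hy.left hy.right (hx.not_adj p hp₁ (by omega))
      (hy.not_adj q' (by omega) hq₃)).elim hcon.1 hcon.2
  · refine ((hB.swap hf).containsTheta_or_containsPrism_of_gap hf (x₁ := y₁) (x₂ := y₂)
      (y₁ := x₁ + n) (y₂ := x₂ + n) hq₁ hq₂ hq₃ hg (by omega) (by omega) (by omega) (by omega)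
      hy.left hy.right ?_ ?_ (hy.not_adj q hq₁ (by omega)) ?_).elim hcon.1 hcon.2 <;>
    rw [hf.add_period]
    · exact hx.left
    · exact hx.right
    · exact hx.not_adj p' (by omega) hp₃

/-- A neighbor `f i` of `c` such that the next neighbors of `d` on both sides come before further
neighbors of `c`, together with a separated arc seen by `c` and `d`, yields a theta. -/
theorem containsTheta_of_isolated (hw : IsWheelParam G n f c) (hdc : d ≠ c) (hadj : ¬ G.Adj d c)
    (hd : ∀ t, f t ≠ d) {s i t u w j k : ℤ} (hsi : s < i) (hit : i < t) (hci : G.Adj c (f i))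
    (hdi : ¬ G.Adj d (f i)) (hds : G.Adj d (f s)) (hdt : G.Adj d (f t))
    (hc : ∀ l, s ≤ l → l ≤ t → l ≠ i → ¬ G.Adj c (f l)) (htu : t + 2 ≤ u) (hws : w + 2 ≤ s + n)
    (hj : j ∈ Set.Icc u w) (hk : k ∈ Set.Icc u w) (hcj : G.Adj c (f j)) (hdk : G.Adj d (f k)) :
    ContainsTheta G := by
  have hf := hw.toIsHoleParam
  have hj' := hj.1.trans hj.2
  refine hf.containsTheta_of_two_arcs (hd i) (fun h => hdi h.symm)
    (s₁ := s) (t₁ := i - 1) (s₂ := i + 1) (t₂ := t) (by omega) (by omega)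
    (i₁ := i - 1) (j₁ := s) (i₂ := i + 1) (j₂ := t) ⟨by omega, by omega⟩ ⟨by omega, by omega⟩
    ⟨by omega, by omega⟩ ⟨by omega, by omega⟩ (hf.adj_of_eq (by ring)).symm hds
    (hf.adj_succ _) hdt (S := insert c (Arc f u w)) ?_ ?_
  · exact (Reaches.of_adj hci.symm (by simp) (by simp)).trans
      (hf.reaches_via_arc hj hk hcj hdk (by simp) (by simp)
        fun x hx => Or.inr (Or.inr (Or.inr hx)))
  · rintro x (rfl | ⟨l, ⟨hl, hl'⟩, rfl⟩) m hm
    · refine ⟨hw.center m, hc m ?_ ?_ ?_⟩ <;> rcases hm with ⟨hm, hm'⟩ | ⟨hm, hm'⟩ <;> omega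
    · have hm : s ≤ m ∧ m ≤ t := by rcases hm with ⟨hm, hm'⟩ | ⟨hm, hm'⟩ <;> omega
      exact ⟨hf.ne (by omega) (by omega), fun h => hf.not_adj (by omega) (by omega) h.symm⟩

theorem containsTheta_of_tight (hw : IsWheelParam G n f c) (hn : 7 ≤ n) (hdc : d ≠ c)
    (hadj : ¬ G.Adj d c) (hd : ∀ t, f t ≠ d) (hcd : ∀ t, G.Adj c (f t) → ¬ G.Adj d (f t))
    (hx : IsSectorParam G f c x₁ x₂) (hy : IsSectorParam G f c y₁ y₂)
    (hz : IsSectorParam G f c z₁ z₂) (hxy : x₂ ≤ y₁) (hyz : y₂ ≤ z₁) (hzx : z₂ ≤ x₁ + n)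
    (hp₁ : x₁ < p) (hp₂ : p < x₂) (hq₁ : y₁ < q) (hq₂ : q < y₂) (hr₁ : z₁ < r) (hr₂ : r < z₂)
    (hp : G.Adj d (f p)) (hq : G.Adj d (f q)) (hr : G.Adj d (f r)) (htight : y₁ ≤ p + 1) :
    ContainsTheta G := by
  have hf := hw.toIsHoleParam
  obtain rfl : x₂ = p + 1 := by omega
  obtain rfl : y₁ = p + 1 := by omega
  by_contra hcon
  have pq := fun u w j k => hw.containsTheta_of_isolated hdc hadj hd (s := p) (i := p + 1) (t := q)
    (u := u) (w := w) (j := j) (k := k) (by omega) (by omega) hx.right (hcd _ hx.right) hp hq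
    (fun l h₁ h₂ h₃ => by
      rcases lt_or_gt_of_ne h₃ with h | h
      · exact hx.not_adj l (by omega) h
      · exact hy.not_adj l h (by omega))
  have h₁ : q + 1 = y₂ ∧ y₂ = z₁ := by
    by_contra h
    exact hcon (pq z₁ r z₁ r (by omega) (by omega) ⟨by omega, by omega⟩ ⟨by omega, by omega⟩
      hz.left hr)
  obtain ⟨rfl, rfl⟩ := h₁
  have qr := fun u w j k => hw.containsTheta_of_isolated hdc hadj hd (s := q) (i := q + 1) (t := r)
    (u := u) (w := w) (j := j) (k := k) (by omega) (by omega) hy.right (hcd _ hy.right) hq hr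
    (fun l h₁ h₂ h₃ => by
      rcases lt_or_gt_of_ne h₃ with h | h
      · exact hy.not_adj l (by omega) h
      · exact hz.not_adj l h (by omega))
  have h₂ : r + 1 = z₂ ∧ z₂ = x₁ + n := by
    by_contra h
    exact hcon (qr (x₁ + n) (p + n) (x₁ + n) (p + n) (by omega) (by omega) ⟨by omega, by omega⟩
      ⟨by omega, by omega⟩ (by rw [hf.add_period]; exact hx.left)
      (by rw [hf.add_period]; exact hp))
  have h₃ : p = x₁ + 1 := by
    by_contra h
    exact hcon (pq r z₂ z₂ r (by omega) (by omega) ⟨by omega, by omega⟩ ⟨by omega, by omega⟩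
      hz.right hr)
  have h₄ : q = p + 2 := by
    by_contra h
    exact hcon (qr (p + n) (p + 1 + n) (p + 1 + n) (p + n) (by omega) (by omega)
      ⟨by omega, by omega⟩ ⟨by omega, by omega⟩ (by rw [hf.add_period]; exact hx.right)
      (by rw [hf.add_period]; exact hp))
  refine hcon (hw.containsTheta_of_isolated hdc hadj hd (s := r) (i := z₂) (t := p + n)
    (u := q + n) (w := q + 1 + n) (j := q + 1 + n) (k := q + n) (by omega) (by omega) hz.right
    (hcd _ hz.right) hr (by rw [hf.add_period]; exact hp) ?_ (by omega) (by omega)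
    ⟨by omega, by omega⟩ ⟨by omega, by omega⟩ (by rw [hf.add_period]; exact hy.right)
    (by rw [hf.add_period]; exact hq))
  intro l h₁ h₂ h₃
  rcases lt_or_gt_of_ne h₃ with h | h
  · exact hz.not_adj l (by omega) h
  · have := hx.not_adj (l - n) (by omega) (by omega)
    rwa [← hf.add_period, sub_add_cancel] at this

theorem _root_.Paper.IsSectorParam.add_period (hx : IsSectorParam G f c x₁ x₂)
    (hf : IsHoleParam G n f) : IsSectorParam G f c (x₁ + n) (x₂ + n) where
  lt := by have := hx.lt; omega
  left := by rw [hf.add_period]; exact hx.left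
  right := by rw [hf.add_period]; exact hx.right
  not_adj t h₁ h₂ := by
    have := hx.not_adj (t - n) (by omega) (by omega)
    rwa [← hf.add_period, sub_add_cancel] at this

/-- In a theta-free graph, a vertex that is neither adjacent to `c` nor has a common neighbor with
`c` on the hole does not see the interiors of three sectors. -/
theorem containsTheta_of_three_sectors (hw : IsWheelParam G n f c) (hn : 7 ≤ n) (hdc : d ≠ c)
    (hadj : ¬ G.Adj d c) (hd : ∀ t, f t ≠ d) (hcd : ∀ t, G.Adj c (f t) → ¬ G.Adj d (f t))
    (hx : IsSectorParam G f c x₁ x₂) (hy : IsSectorParam G f c y₁ y₂)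
    (hz : IsSectorParam G f c z₁ z₂) (hxy : x₂ ≤ y₁) (hyz : y₂ ≤ z₁) (hzx : z₂ ≤ x₁ + n)
    (hp₁ : x₁ < p) (hp₂ : p < x₂) (hq₁ : y₁ < q) (hq₂ : q < y₂) (hr₁ : z₁ < r) (hr₂ : r < z₂)
    (hp : G.Adj d (f p)) (hq : G.Adj d (f q)) (hr : G.Adj d (f r)) :
    ContainsTheta G := by
  have hf := hw.toIsHoleParam
  have hx' := hx.add_period hf
  have hy' := hy.add_period hf
  have hpn : G.Adj d (f (p + n)) := by rw [hf.add_period]; exact hp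
  have hqn : G.Adj d (f (q + n)) := by rw [hf.add_period]; exact hq
  by_cases h₁ : y₁ ≤ p + 1
  · exact hw.containsTheta_of_tight hn hdc hadj hd hcd hx hy hz hxy hyz hzx hp₁ hp₂ hq₁ hq₂ hr₁ hr₂
      hp hq hr h₁
  by_cases h₂ : z₁ ≤ q + 1
  · exact hw.containsTheta_of_tight hn hdc hadj hd hcd hy hz hx' hyz hzx (by omega) hq₁ hq₂ hr₁ hr₂
      (by omega) (by omega) hq hr hpn h₂
  by_cases h₃ : x₁ + n ≤ r + 1
  · exact hw.containsTheta_of_tight hn hdc hadj hd hcd hz hx' hy' hzx (by omega) (by omega) hr₁ hr₂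
      (by omega) (by omega) (by omega) (by omega) hr hpn hqn h₃
  refine hf.containsTheta_of_two_arcs hdc hadj (s₁ := x₁) (t₁ := p) (s₂ := y₁) (t₂ := q)
    (by omega) (by omega) (i₁ := p) (j₁ := x₁) (i₂ := q) (j₂ := y₁) ⟨by omega, by omega⟩
    ⟨by omega, by omega⟩ ⟨by omega, by omega⟩ ⟨by omega, by omega⟩ hp hx.left hq hy.left
    (S := Arc f z₁ r) ?_ ?_
  · exact hf.reaches_via_arc (s := z₁) (t := r) (i := r) (j := z₁) ⟨by omega, by omega⟩
      ⟨by omega, by omega⟩ hr hz.left (by simp) (by simp) fun x hx => Or.inr (Or.inr hx)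
  · rintro _ ⟨l, ⟨hl, hl'⟩, rfl⟩ m hm
    have hm : x₁ ≤ m ∧ m ≤ q := by rcases hm with ⟨hm, hm'⟩ | ⟨hm, hm'⟩ <;> omega
    exact ⟨hf.ne (by omega) (by omega), fun h => hf.not_adj (by omega) (by omega) h.symm⟩

end IsWheelParam

/-- The vertex `z` is neither `c`, nor adjacent to `c`, nor adjacent to a neighbor of `c` on the
hole parametrized by `f`. -/
structure IsRemote (G : SimpleGraph V) (f : ℤ → V) (c z : V) : Prop where
  ne : z ≠ c
  not_adj : ¬ G.Adj z c
  not_adj_nbr : ∀ t, G.Adj c (f t) → ¬ G.Adj z (f t)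

/-- Some neighbor of `c` has its index strictly between `i` and `j`. -/
def IsSplit (G : SimpleGraph V) (f : ℤ → V) (c : V) (i j : ℤ) : Prop :=
  ∃ y, G.Adj c (f y) ∧ (i < y ∧ y < j ∨ j < y ∧ y < i)

theorem IsSplit.symm {G : SimpleGraph V} {f : ℤ → V} {c : V} {i j : ℤ}
    (h : IsSplit G f c i j) : IsSplit G f c j i := by
  obtain ⟨y, hy, h⟩ := h
  exact ⟨y, hy, h.symm⟩

theorem IsSplit.left_or_right {G : SimpleGraph V} {f : ℤ → V} {c : V} {i j k : ℤ}
    (h : IsSplit G f c i j) (hk : ¬ G.Adj c (f k)) :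
    IsSplit G f c i k ∨ IsSplit G f c k j := by
  obtain ⟨y, hy, h⟩ := h
  have hyk : y ≠ k := fun e => hk (e ▸ hy)
  by_cases h' : i < y ∧ y < k ∨ k < y ∧ y < i
  · exact .inl ⟨y, hy, h'⟩
  · exact .inr ⟨y, hy, by omega⟩

namespace IsWheelParam

variable {G : SimpleGraph V} {n : ℤ} {f : ℤ → V} {c : V} {i j : ℤ}

theorem exists_sector (hw : IsWheelParam G n f c) (h0 : G.Adj c (f 0)) (hi : 0 ≤ i) (hin : i < n)
    (hci : ¬ G.Adj c (f i)) :
    ∃ x y, 0 ≤ x ∧ x < i ∧ i < y ∧ y ≤ n ∧ IsSectorParam G f c x y := by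
  have hn0 : G.Adj c (f n) := by
    have := hw.add_period 0
    rw [zero_add] at this
    rwa [this]
  have hne : i ≠ 0 := by rintro rfl; exact hci h0
  obtain ⟨x, ⟨hx, hcx⟩, hmax⟩ := Int.exists_greatest_of_bdd
    (P := fun t => t < i ∧ G.Adj c (f t)) ⟨i, fun z hz => hz.1.le⟩ ⟨0, by omega, h0⟩
  obtain ⟨y, ⟨hy, hcy⟩, hmin⟩ := Int.exists_least_of_bdd
    (P := fun t => i < t ∧ G.Adj c (f t)) ⟨i, fun z hz => hz.1.le⟩ ⟨n, hin, hn0⟩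
  refine ⟨x, y, hmax 0 ⟨by omega, h0⟩, hx, hy, hmin n ⟨hin, hn0⟩, by omega, hcx, hcy,
    fun t ht ht' hct => ?_⟩
  rcases lt_trichotomy t i with h | rfl | h
  · have := hmax t ⟨h, hct⟩
    omega
  · exact hci hct
  · have := hmin t ⟨h, hct⟩
    omega

theorem containsTheta_or_containsPrism_of_minimal_walk (hw : IsWheelParam G n f c) (hn : 7 ≤ n)
    (h0 : G.Adj c (f 0)) (hi : 0 ≤ i) (hjn : j < n) (hij : i < j) (hci : ¬ G.Adj c (f i))
    (hcj : ¬ G.Adj c (f j)) (hs : IsSplit G f c i j) (w : G.Walk (f i) (f j))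
    (hoff : ∀ k t, 0 < k → k < w.length → f t ≠ w.getVert k)
    (hrem : ∀ k, 0 < k → k < w.length → IsRemote G f c (w.getVert k))
    (hleft : ∀ k t, 0 < k → k < w.length → 0 ≤ t → t < n → G.Adj (w.getVert k) (f t) →
      IsSplit G f c i t → k + 1 = w.length)
    (hright : ∀ k t, 0 < k → k < w.length → 0 ≤ t → t < n → G.Adj (w.getVert k) (f t) →
      IsSplit G f c t j → k = 1) :
    ContainsTheta G ∨ ContainsPrism G := by
  have hf := hw.toIsHoleParam
  obtain ⟨x₁, x₂, hx0, hx₁, hx₂, hxn, hx⟩ := hw.exists_sector h0 hi (by omega) hci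
  obtain ⟨y₁, y₂, hy0, hy₁, hy₂, hyn, hy⟩ := hw.exists_sector h0 (by omega) hjn hcj
  obtain ⟨y, hcy, hy'⟩ := hs
  have hx₂y : x₂ ≤ y := by
    by_contra!
    exact hx.not_adj y (by omega) this hcy
  have hyy₁ : y ≤ y₁ := by
    by_contra!
    exact hy.not_adj y this (by omega) hcy
  have hL : 2 ≤ w.length := two_le_length_of_not_adj w (hf.ne hij (by omega))
    (hf.not_adj (by omega) (by omega))
  have hd : G.Adj (w.getVert 1) (f i) := by
    simpa using (w.adj_getVert_succ (i := 0) (by omega)).symm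
  have he : G.Adj (w.getVert (w.length - 1)) (f j) := by
    have := w.adj_getVert_succ (i := w.length - 1) (by omega)
    rwa [Nat.sub_add_cancel (by omega), Walk.getVert_length] at this
  by_cases hcase : ∃ k t, 0 < k ∧ k < w.length ∧ 0 ≤ t ∧ t < n ∧ G.Adj (w.getVert k) (f t) ∧
      IsSplit G f c i t ∧ IsSplit G f c t j
  · left
    obtain ⟨k, t, hk, hk', ht, htn, hadj, hit, htj⟩ := hcase
    have h1 := hleft k t hk hk' ht htn hadj hit
    obtain rfl := hright k t hk hk' ht htn hadj htj
    rw [show w.length - 1 = 1 by omega] at he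
    have hr := hrem 1 hk hk'
    have hct : ¬ G.Adj c (f t) := fun h => hr.not_adj_nbr t h hadj
    obtain ⟨z₁, z₂, hz0, hz₁, hz₂, hzn, hz⟩ := hw.exists_sector h0 ht htn hct
    obtain ⟨u, hcu, hu⟩ := hit
    obtain ⟨v, hcv, hv⟩ := htj
    have hux : ¬ (x₁ < u ∧ u < x₂) := fun h => hx.not_adj u h.1 h.2 hcu
    have huz : ¬ (z₁ < u ∧ u < z₂) := fun h => hz.not_adj u h.1 h.2 hcu
    have hvy : ¬ (y₁ < v ∧ v < y₂) := fun h => hy.not_adj v h.1 h.2 hcv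
    have hvz : ¬ (z₁ < v ∧ v < z₂) := fun h => hz.not_adj v h.1 h.2 hcv
    have hcd := hr.not_adj_nbr
    rcases lt_trichotomy t i with h | rfl | h
    · exact hw.containsTheta_of_three_sectors hn hr.ne hr.not_adj (hoff 1 · hk hk') hcd
        hz hx hy (by omega) (by omega) (by omega) hz₁ hz₂ hx₁ hx₂ hy₁ hy₂ hadj hd he
    · omega
    rcases lt_trichotomy t j with h' | rfl | h'
    · exact hw.containsTheta_of_three_sectors hn hr.ne hr.not_adj (hoff 1 · hk hk') hcd
        hx hz hy (by omega) (by omega) (by omega) hx₁ hx₂ hz₁ hz₂ hy₁ hy₂ hd hadj he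
    · omega
    · exact hw.containsTheta_of_three_sectors hn hr.ne hr.not_adj (hoff 1 · hk hk') hcd
        hx hy hz (by omega) (by omega) (by omega) hx₁ hx₂ hy₁ hy₂ hz₁ hz₂ hd he hadj
  · set M : Set V := {z | ∃ k, 0 < k ∧ k < w.length ∧ w.getVert k = z} with hM
    have hmem : ∀ k, 0 < k → k < w.length → w.getVert k ∈ M := fun k hk hk' => ⟨k, hk, hk', rfl⟩
    have hreach : ∀ k, k + 1 < w.length → Reaches G M (w.getVert 1) (w.getVert (k + 1)) := by
      intro k
      induction k with
      | zero => exact fun h => .refl (hmem 1 (by omega) (by omega))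
      | succ k ih =>
        exact fun h => (ih (by omega)).trans (.of_adj (w.adj_getVert_succ (by omega))
          (hmem _ (by omega) (by omega)) (hmem _ (by omega) h))
    have hr := hreach (w.length - 2) (by omega)
    rw [show w.length - 2 + 1 = w.length - 1 by omega] at hr
    refine hw.containsTheta_or_containsPrism_of_two_sectors hx hy (by omega) (by omega) (M := M)
      ?_ ?_ ?_ (hmem 1 (by omega) (by omega)) (hmem (w.length - 1) (by omega) (by omega)) hr
      ⟨i, hx₁, hx₂, hd⟩ ⟨j, hy₁, hy₂, he⟩ ?_
    · rintro t ⟨k, hk, hk', h⟩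
      exact hoff k t hk hk' h.symm
    · rintro ⟨k, hk, hk', h⟩
      exact (hrem k hk hk').ne h
    · rintro m ⟨k, hk, hk', rfl⟩
      exact (hrem k hk hk').not_adj
    · rintro m ⟨k, hk, hk', rfl⟩ t hadj
      obtain ⟨s, hs, hsn, hst⟩ := hf.exists_representative 0 t
      rw [← hst] at hadj ⊢
      have hcs : ¬ G.Adj c (f s) := fun h => (hrem k hk hk').not_adj_nbr s h hadj
      have hsx : s ≠ x₁ ∧ s ≠ x₂ ∧ s ≠ y₁ ∧ s ≠ y₂ :=
        ⟨by rintro rfl; exact hcs hx.left, by rintro rfl; exact hcs hx.right,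
          by rintro rfl; exact hcs hy.left, by rintro rfl; exact hcs hy.right⟩
      by_cases hi' : x₁ < s ∧ s < x₂
      · have := hright k s hk hk' hs (by omega) hadj ⟨x₂, hx.right, by omega⟩
        exact .inl ⟨by rw [this], s, hi'.1, hi'.2, rfl⟩
      · have hsp : IsSplit G f c i s := by
          by_cases s < i
          · exact ⟨x₁, hx.left, by omega⟩
          · exact ⟨x₂, hx.right, by omega⟩
        have hj' : y₁ < s ∧ s < y₂ := by
          by_contra hj'
          apply hcase ⟨k, s, hk, hk', hs, by omega, hadj, hsp, ?_⟩
          by_cases s < j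
          · exact ⟨y₁, hy.left, by omega⟩
          · exact ⟨y₂, hy.right, by omega⟩
        have := hleft k s hk hk' hs (by omega) hadj hsp
        exact .inr ⟨by rw [← this, Nat.add_sub_cancel], s, hj'.1, hj'.2, rfl⟩

theorem containsTheta_or_containsPrism_of_walk (hw : IsWheelParam G n f c) (hn : 7 ≤ n)
    (h0 : G.Adj c (f 0)) (hi : 0 ≤ i) (hin : i < n) (hj : 0 ≤ j) (hjn : j < n)
    (hci : ¬ G.Adj c (f i)) (hcj : ¬ G.Adj c (f j)) (hs : IsSplit G f c i j)
    (w : G.Walk (f i) (f j))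
    (hsupp : ∀ z ∈ w.support, IsRemote G f c z ∨ ∃ t, f t = z ∧ ¬ G.Adj c z) :
    ContainsTheta G ∨ ContainsPrism G := by
  induction hl : w.length using Nat.strong_induction_on generalizing i j with
  | _ l ih =>
  subst hl
  wlog hij : i < j generalizing i j
  · refine this hj hjn hi hin hcj hci hs.symm w.reverse (by simpa using hsupp) ?_ ?_
    · simpa using fun m hm => @ih m hm
    · obtain ⟨y, -, hy⟩ := hs
      omega
  have split : ∀ k t, 0 ≤ t → t < n → ¬ G.Adj c (f t) →
      ∀ p : G.Walk (w.getVert k) (f t), p.support ⊆ [w.getVert k, f t] →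
      (IsSplit G f c i t → k ≤ w.length → k + p.length < w.length →
        ContainsTheta G ∨ ContainsPrism G) ∧
      (IsSplit G f c t j → p.length < k → k ≤ w.length → ContainsTheta G ∨ ContainsPrism G) := by
    intro k t ht htn hct p hp
    have hz : ∀ z ∈ p.support, IsRemote G f c z ∨ ∃ t, f t = z ∧ ¬ G.Adj c z := by
      intro z hz
      have := hp hz
      simp only [List.mem_cons, List.not_mem_nil, or_false] at this
      rcases this with rfl | rfl
      · exact hsupp _ (w.getVert_mem_support k)
      · exact .inr ⟨t, rfl, hct⟩
    refine ⟨fun hit hk hlt => ?_, fun htj hlt hk => ?_⟩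
    · refine ih _ ?_ hi hin ht htn hci hct hit ((w.take k).append p) ?_ rfl
      · rw [Walk.length_append, Walk.take_length]
        omega
      · intro z hz'
        rw [Walk.mem_support_append_iff] at hz'
        exact hz'.elim (fun h => hsupp z (support_take_subset _ _ z h)) (hz z)
    · refine ih _ ?_ ht htn hj hjn hct hcj htj (p.reverse.append (w.drop k)) ?_ rfl
      · rw [Walk.length_append, Walk.drop_length, Walk.length_reverse]
        omega
      · intro z hz'
        rw [Walk.mem_support_append_iff, Walk.support_reverse, List.mem_reverse] at hz'
        exact hz'.elim (hz z) (fun h => hsupp z (support_drop_subset _ _ z h))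
  by_contra hcon
  have hoff : ∀ k t, 0 < k → k < w.length → f t ≠ w.getVert k := by
    intro k t hk hk' h
    obtain ⟨s, hs0, hsn, hst⟩ := hw.toIsHoleParam.exists_representative 0 t
    rw [← hst] at h
    have hcs : ¬ G.Adj c (f s) := by
      rw [h]
      rcases hsupp _ (w.getVert_mem_support k) with h' | ⟨_, -, h'⟩
      · exact fun h => h'.not_adj h.symm
      · exact h'
    have := split k s hs0 (by omega) hcs (Walk.nil.copy rfl h.symm) (by simp)
    rcases hs.left_or_right hcs with h' | h'
    · exact hcon (this.1 h' hk'.le (by simpa using hk'))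
    · exact hcon (this.2 h' (by simpa using hk) hk'.le)
  have hrem : ∀ k, 0 < k → k < w.length → IsRemote G f c (w.getVert k) := by
    intro k hk hk'
    rcases hsupp _ (w.getVert_mem_support k) with h' | ⟨t, h', -⟩
    · exact h'
    · exact absurd h' (hoff k t hk hk')
  refine hcon (hw.containsTheta_or_containsPrism_of_minimal_walk hn h0 hi hjn hij hci hcj hs w
    hoff hrem ?_ ?_)
  · intro k t hk hk' ht htn hadj hit
    by_contra hne
    exact hcon ((split k t ht htn (fun h => (hrem k hk hk').not_adj_nbr t h hadj)
      (.cons hadj .nil) (by simp)).1 hit hk'.le (by simp; omega))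
  · intro k t hk hk' ht htn hadj htj
    by_contra hne
    exact hcon ((split k t ht htn (fun h => (hrem k hk hk').not_adj_nbr t h hadj)
      (.cons hadj .nil) (by simp)).2 htj (by simp; omega) hk'.le)

end IsWheelParam

theorem IsHoleWalk.exists_param {G : SimpleGraph V} {h : V} {H : G.Walk h h}
    (hH : IsHoleWalk G H) :
    ∃ f, IsHoleParam G H.length f ∧ ∀ v, v ∈ H.support ↔ ∃ i, f i = v := by
  obtain ⟨hcyc, h4, hind⟩ := hH
  have hpos : (0 : ℤ) < H.length := by omega
  set f : ℤ → V := fun i => H.getVert (i % H.length).toNat with hf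
  have hmod : ∀ i : ℤ, 0 ≤ i % H.length ∧ i % H.length < H.length := fun i =>
    ⟨Int.emod_nonneg _ (by omega), Int.emod_lt_of_pos _ hpos⟩
  have hfk : ∀ k : ℕ, k ≤ H.length → f k = H.getVert k := by
    intro k hk
    rcases hk.eq_or_lt with rfl | hk
    · simp [hf]
    · simp only [hf]
      rw [Int.emod_eq_of_lt (by omega) (by omega), Int.toNat_natCast]
  have heq : ∀ i j, f i = f j ↔ (H.length : ℤ) ∣ j - i := by
    intro i j
    rw [Int.dvd_iff_emod_eq_zero, ← Int.emod_eq_emod_iff_emod_sub_eq_zero]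
    refine ⟨fun hij => ?_, fun hij => by simp only [hf, hij]⟩
    have hi := hmod i
    have hj := hmod j
    have := hcyc.getVert_injOn' (by rw [Set.mem_ofPred_eq]; omega)
      (by rw [Set.mem_ofPred_eq]; omega) hij
    omega
  have hsucc : ∀ i, G.Adj (f i) (f (i + 1)) := by
    intro i
    have hi := hmod i
    obtain ⟨k, hk⟩ := Int.eq_ofNat_of_zero_le hi.1
    have hki : f i = f k := by
      rw [heq, ← hk]
      exact ⟨-(i / H.length), by have := Int.emod_add_mul_ediv i H.length; linarith⟩
    have hki' : f (i + 1) = f (k + 1 : ℕ) := by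
      rw [heq] at hki ⊢
      convert hki using 1
      push_cast
      ring
    rw [hki, hki', hfk k (by omega), hfk (k + 1) (by omega)]
    exact H.adj_getVert_succ (by omega)
  have hmem : ∀ i, f i ∈ H.support := fun i => H.getVert_mem_support _
  refine ⟨f, ⟨by omega, heq, fun i j => ⟨fun hadj => ?_, ?_⟩⟩, fun v => ⟨fun hv => ?_, ?_⟩⟩
  · obtain ⟨k, hk, hkij⟩ :=
      (Walk.mk_mem_edges_iff_exists H).mp (hind _ (hmem i) _ (hmem j) hadj)
    rw [← hfk k hk.le, ← hfk (k + 1) hk, Sym2.eq_iff, heq, heq, heq, heq] at hkij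
    push_cast at hkij
    rcases hkij with ⟨h₁, h₂⟩ | ⟨h₁, h₂⟩
    · exact .inl ((dvd_sub h₂ h₁).trans (dvd_of_eq (by ring)))
    · exact .inr ((dvd_sub h₁ h₂).trans (dvd_of_eq (by ring)))
  · rintro (hd | hd)
    · rw [(heq j (i + 1)).mpr (by rw [← dvd_neg]; simpa [sub_sub, add_comm] using hd)]
      exact hsucc i
    · rw [(heq i (j + 1)).mpr (by convert hd using 1; ring)]
      exact (hsucc j).symm
  · obtain ⟨k, rfl, hk⟩ := Walk.mem_support_iff_exists_getVert.mp hv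
    exact ⟨k, hfk k hk⟩
  · rintro ⟨i, rfl⟩
    exact hmem i

theorem IsWheel.exists_param {G : SimpleGraph V} {h c : V} {H : G.Walk h h}
    (hW : IsWheel G H c) (hns : ¬ IsSpecialWheel G H c) :
    ∃ f, IsWheelParam G H.length f c ∧ G.Adj c (f 0) ∧ ∀ v, v ∈ H.support ↔ ∃ i, f i = v := by
  obtain ⟨hH, hc, h3⟩ := id hW
  obtain ⟨f, hf, h0, hmem⟩ : ∃ f, IsHoleParam G H.length f ∧ G.Adj c (f 0) ∧
      ∀ v, v ∈ H.support ↔ ∃ i, f i = v := by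
    obtain ⟨g, hg, hgmem⟩ := hH.exists_param
    have hne : (HoleNbrs G H c).Nonempty := by
      rw [Set.nonempty_iff_ne_empty]
      intro h
      rw [h, Set.ncard_empty] at h3
      omega
    obtain ⟨v, hv, hcv⟩ := hne
    obtain ⟨k, rfl⟩ := (hgmem v).mp hv
    exact ⟨fun i => g (i + k), hg.shift k, by simpa using hcv, fun v => (hgmem v).trans
      ⟨fun ⟨i, hi⟩ => ⟨i - k, by simpa using hi⟩, fun ⟨i, hi⟩ => ⟨i + k, hi⟩⟩⟩
  have hedge : ∀ i j, s(f i, f j) ∈ H.edges ↔ G.Adj (f i) (f j) := fun i j =>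
    ⟨H.adj_of_mem_edges, hH.2.2 _ ((hmem _).mpr ⟨i, rfl⟩) _ ((hmem _).mpr ⟨j, rfl⟩)⟩
  refine ⟨f, { hf with center := ?_, three_nbrs := ?_, not_special := ?_ }, h0, hmem⟩
  · intro t ht
    exact hc ((hmem c).mpr ⟨t, ht⟩)
  · intro i j
    by_contra! hcon
    have hsub : HoleNbrs G H c ⊆ {f i, f j} := by
      rintro v ⟨hv, hcv⟩
      obtain ⟨t, rfl⟩ := (hmem v).mp hv
      by_cases h : f t = f i
      · exact .inl h
      · exact .inr (hcon t hcv h)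
    have := Set.ncard_le_ncard hsub (Set.toFinite _)
    have := Set.ncard_insert_le (f i) {f j}
    rw [Set.ncard_singleton] at this
    omega
  · intro i j hi hi' hj hij hji
    by_contra! hcon
    refine hns ⟨hW, f i, f (i + 1), f j, hf.ne (by omega) (by omega), hf.ne (by omega) (by omega),
      hf.ne (by omega) (by omega), ?_, (hedge _ _).mpr (hf.adj_succ i),
      fun h => hf.not_adj (by omega) (by omega) ((hedge _ _).mp h),
      fun h => hf.not_adj (by omega) (by omega) ((hedge _ _).mp h)⟩
    ext v
    refine ⟨?_, ?_⟩
    · rintro ⟨hv, hcv⟩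
      obtain ⟨t, rfl⟩ := (hmem v).mp hv
      by_cases h : f t = f i
      · exact .inl h
      by_cases h' : f t = f (i + 1)
      · exact .inr (.inl h')
      · exact .inr (.inr (hcon t hcv h h'))
    · have hm : ∀ t, f t ∈ H.support := fun t => (hmem _).mpr ⟨t, rfl⟩
      rintro (rfl | rfl | rfl)
      exacts [⟨hm _, hi⟩, ⟨hm _, hi'⟩, ⟨hm _, hj⟩]

/-- A walk along the hole that starts inside a sector and stops at the first neighbor of the center
traverses the sector from its start to one of its ends. -/
theorem IsSectorParam.support_of_walk {G : SimpleGraph V} {n : ℤ} {f : ℤ → V} {c : V} {x y : ℤ}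
    (hx : IsSectorParam G f c x y) (hf : IsHoleParam G n f) {u v : V} {p : G.Walk u v}
    (hpath : p.IsPath) {t : ℤ}
    (hxt : x ≤ t) (hty : t ≤ y) (ht : f t = u) (hhole : ∀ z ∈ p.support, ∃ s, f s = z)
    (hv : G.Adj c v) (hp : ∀ z ∈ p.support, z ≠ v → ¬ G.Adj c z) :
    (∀ z ∈ p.support, z ∈ Arc f x y) ∧
      (v = f x ∧ (∀ z ∈ Arc f x t, z ∈ p.support) ∨
        v = f y ∧ (∀ z ∈ Arc f t y, z ∈ p.support)) := by
  induction p generalizing t with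
  | nil =>
    subst ht
    refine ⟨fun z hz => ?_, ?_⟩
    · rw [Walk.support_nil, List.mem_singleton] at hz
      exact hz ▸ mem_arc hxt hty
    · have : t = x ∨ t = y := by
        by_contra h
        exact hx.not_adj t (by omega) (by omega) hv
      rcases this with rfl | rfl
      · exact .inl ⟨rfl, by simp [Arc]⟩
      · exact .inr ⟨rfl, by simp [Arc]⟩
  | @cons u u' v hadj q ih =>
    subst ht
    rw [Walk.cons_isPath_iff] at hpath
    have hend : f t ≠ v := fun h => hpath.2 (h ▸ q.end_mem_support)
    have hct : ¬ G.Adj c (f t) := hp _ (by simp) hend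
    have htx : t ≠ x := by rintro rfl; exact hct hx.left
    have hty' : t ≠ y := by rintro rfl; exact hct hx.right
    have hq : ∀ z ∈ q.support, z ∈ (Walk.cons hadj q).support := fun z hz => by simp [hz]
    obtain ⟨s, hs⟩ := hhole u' (hq _ q.start_mem_support)
    have hcases : f (t + 1) = u' ∨ f (t - 1) = u' := by
      rw [← hs] at hadj ⊢
      rcases (hf.adj_iff t s).mp hadj with h | h
      · exact .inl ((hf.eq_iff _ _).mpr (by convert h using 1; ring))
      · exact .inr ((hf.eq_iff _ _).mpr (by convert h using 1; ring))
    rcases hcases with h | h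
    · obtain ⟨h₁, h₂⟩ := ih hpath.1 (by omega) (by omega) h (fun z hz => hhole z (hq z hz)) hv
        (fun z hz => hp z (hq z hz))
      refine ⟨?_, h₂.imp (And.imp_right fun h₃ => ?_) (And.imp_right fun h₃ => ?_)⟩
      · intro z hz
        rw [Walk.support_cons, List.mem_cons] at hz
        exact hz.elim (fun h => h ▸ mem_arc hxt hty) (h₁ z)
      · rintro _ ⟨r, ⟨hr, hr'⟩, rfl⟩
        exact hq _ (h₃ _ (mem_arc hr (by omega)))
      · rintro _ ⟨r, ⟨hr, hr'⟩, rfl⟩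
        rcases hr.eq_or_lt with rfl | hr
        · simp
        · exact hq _ (h₃ _ (mem_arc hr hr'))
    · obtain ⟨h₁, h₂⟩ := ih hpath.1 (by omega) (by omega) h (fun z hz => hhole z (hq z hz)) hv
        (fun z hz => hp z (hq z hz))
      refine ⟨?_, h₂.imp (And.imp_right fun h₃ => ?_) (And.imp_right fun h₃ => ?_)⟩
      · intro z hz
        rw [Walk.support_cons, List.mem_cons] at hz
        exact hz.elim (fun h => h ▸ mem_arc hxt hty) (h₁ z)
      · rintro _ ⟨r, ⟨hr, hr'⟩, rfl⟩
        rcases hr'.eq_or_lt with rfl | hr'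
        · simp
        · exact hq _ (h₃ _ (mem_arc hr (by omega)))
      · rintro _ ⟨r, ⟨hr, hr'⟩, rfl⟩
        exact hq _ (h₃ _ (mem_arc (by omega) hr'))

theorem IsSector.support_eq_arc {G : SimpleGraph V} {n : ℤ} {f : ℤ → V} {h c u v : V}
    {H : G.Walk h h} {P : G.Walk u v} {x i y : ℤ} (hP : IsSector G H c P) (hf : IsHoleParam G n f)
    (hmem : ∀ v, v ∈ H.support ↔ ∃ i, f i = v) (hx : IsSectorParam G f c x y) (hxi : x ≤ i)
    (hiy : i ≤ y) (hi : f i ∈ Interior P) : {w | w ∈ P.support} = Arc f x y := by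
  classical
  obtain ⟨hpath, -, hhole, -, hu, hv, hint⟩ := hP
  obtain ⟨hiP, hiu, hiv⟩ := hi
  obtain ⟨q, q', rfl⟩ := Walk.mem_support_iff_exists_append.mp hiP
  have hdisj : ∀ z ∈ q.support, z ∈ q'.support → z = f i := by
    intro z hz hz'
    have hnodup := hpath.support_nodup
    rw [Walk.support_append, List.nodup_append] at hnodup
    rw [Walk.mem_support_iff] at hz'
    exact hz'.resolve_right fun h => hnodup.2.2 z hz z h rfl
  have hq : ∀ z ∈ q.support, z ∈ (q.append q').support := fun z hz => by
    rw [Walk.mem_support_append_iff]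
    exact .inl hz
  have hq' : ∀ z ∈ q'.support, z ∈ (q.append q').support := fun z hz => by
    rw [Walk.mem_support_append_iff]
    exact .inr hz
  obtain ⟨h₁, h₂⟩ := hx.support_of_walk hf hpath.of_append_left.reverse hxi hiy rfl
    (fun z hz => (hmem z).mp (hhole z (hq z (by simpa using hz)))) hu
    (fun z hz hzu => hint z (hq z (by simpa using hz)) hzu (by
      rintro rfl
      exact hiv (hdisj _ (by simpa using hz) q'.end_mem_support).symm))
  obtain ⟨h₁', h₂'⟩ := hx.support_of_walk hf hpath.of_append_right hxi hiy rfl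
    (fun z hz => (hmem z).mp (hhole z (hq' z hz))) hv
    (fun z hz hzv => hint z (hq' z hz) (by
      rintro rfl
      exact hiu (hdisj _ q.start_mem_support hz).symm) hzv)
  have hne : u ≠ v := by
    rintro rfl
    exact hiu (hdisj _ q.start_mem_support q'.end_mem_support).symm
  simp only [Walk.support_reverse, List.mem_reverse] at h₁ h₂
  have hsplit : ∀ z ∈ Arc f x y, z ∈ Arc f x i ∨ z ∈ Arc f i y := by
    rintro _ ⟨r, ⟨hr, hr'⟩, rfl⟩
    exact (le_total r i).imp (mem_arc hr) (mem_arc · hr')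
  ext z
  rw [Set.mem_ofPred_eq, Walk.mem_support_append_iff]
  refine ⟨fun hz => hz.elim (h₁ z) (h₁' z), fun hz => ?_⟩
  rcases h₂ with ⟨hux, h₂⟩ | ⟨huy, h₂⟩ <;> rcases h₂' with ⟨hvx, h₂'⟩ | ⟨hvy, h₂'⟩
  · exact absurd (hux.trans hvx.symm) hne
  · exact (hsplit z hz).imp (h₂ z) (h₂' z)
  · exact (hsplit z hz).symm.imp (h₂ z) (h₂' z)
  · exact absurd (huy.trans hvy.symm) hne

theorem separates_of_not_reaches {G : SimpleGraph V} {M : Set V} {a b : V} (ha : a ∉ M)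
    (hb : b ∉ M) (hab : ¬ Reaches G Mᶜ a b) : Separates G M a b := by
  have hL : ∀ {z}, Reaches G Mᶜ a z → z ∉ M := fun ⟨w, hw⟩ => hw _ w.end_mem_support
  refine ⟨{z | Reaches G Mᶜ a z}, {z | z ∉ M ∧ ¬ Reaches G Mᶜ a z}, ?_, ?_, ?_, ?_,
    ⟨a, .refl ha⟩, ⟨b, hb, hab⟩, ?_, .refl ha, hb, hab⟩
  · ext z
    by_cases h : z ∈ M
    · simp [h]
    · simp [h, em]
  · exact Set.disjoint_left.mpr fun z hz hM => hL hz hM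
  · exact Set.disjoint_left.mpr fun z hz hz' => hz'.2 hz
  · exact Set.disjoint_left.mpr fun z hz hz' => hz'.1 hz
  · exact fun l hl r hr hadj => hr.2 (hl.trans (.of_adj hadj (hL hl) hr.1))

/-- breaking a non-special wheel. -/
theorem statement_3 {V : Type} [Fintype V] (G : SimpleGraph V)
    (hth : ¬ ContainsTheta G) (hpr : ¬ ContainsPrism G)
    {h : V} (H : G.Walk h h) (c : V)
    (hW : IsWheel G H c) (hns : ¬ IsSpecialWheel G H c) (hlen : 7 ≤ H.length)
    {x₁ x₂ y₁ y₂ : V} (P : G.Walk x₁ x₂) (Q : G.Walk y₁ y₂)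
    (hP : IsSector G H c P) (hQ : IsSector G H c Q)
    (hPQ : {w | w ∈ P.support} ≠ {w | w ∈ Q.support})
    (a b : V)
    (ha : a ∈ Interior P) (hb : b ∈ Interior Q)
    (haZ : a ∉ ClosedNbhd G (ZNonSpecial G H c))
    (hbZ : b ∉ ClosedNbhd G (ZNonSpecial G H c)) :
    Separates G (ClosedNbhd G (ZNonSpecial G H c)) a b := by
  obtain ⟨f, hw, h0, hmem⟩ := hW.exists_param hns
  have hf := hw.toIsHoleParam
  have hrem : ∀ z, z ∉ ClosedNbhd G (ZNonSpecial G H c) → IsRemote G f c z := fun z hz =>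
    ⟨fun h => hz (.inl (.inl h)), fun h => hz (.inr ⟨c, .inl rfl, h⟩),
      fun t ht h => hz (.inr ⟨f t, .inr ⟨(hmem _).mpr ⟨t, rfl⟩, ht⟩, h⟩)⟩
  obtain ⟨s, rfl⟩ := (hmem a).mp (hP.2.2.1 a ha.1)
  obtain ⟨i, hi, hin, his⟩ := hf.exists_representative 0 s
  obtain ⟨t, rfl⟩ := (hmem b).mp (hQ.2.2.1 b hb.1)
  obtain ⟨j, hj, hjn, hjt⟩ := hf.exists_representative 0 t
  rw [← his] at ha haZ ⊢
  rw [← hjt] at hb hbZ ⊢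
  rw [zero_add] at hin hjn
  have hci : ¬ G.Adj c (f i) := fun h => (hrem _ haZ).not_adj h.symm
  have hcj : ¬ G.Adj c (f j) := fun h => (hrem _ hbZ).not_adj h.symm
  have hsplit : IsSplit G f c i j := by
    obtain ⟨x, y, -, hxi, hiy, -, hx⟩ := hw.exists_sector h0 hi hin hci
    have hjx : j ≠ x := by rintro rfl; exact hcj hx.left
    have hjy : j ≠ y := by rintro rfl; exact hcj hx.right
    rcases lt_or_gt_of_ne hjx with h | h
    · exact ⟨x, hx.left, .inr ⟨h, hxi⟩⟩
    rcases lt_or_gt_of_ne hjy with h' | h'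
    · exact absurd ((hP.support_eq_arc hf hmem hx hxi.le hiy.le ha).trans
        (hQ.support_eq_arc hf hmem hx h.le h'.le hb).symm) hPQ
    · exact ⟨y, hx.right, .inl ⟨hiy, h'⟩⟩
  refine separates_of_not_reaches haZ hbZ ?_
  rintro ⟨w, hwX⟩
  exact (hw.containsTheta_or_containsPrism_of_walk (by exact_mod_cast hlen) h0 hi hin hj hjn hci hcj
    hsplit w fun z hz => .inl (hrem z (hwX z hz))).elim hth hpr

end Paper
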